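/- arXiv:1710.03385 — 2 statements merged into one kernel-verified Lean document; each statement's English description precedes it below -/
import Mathlib

section
/- Let p > q ≥ 1 be integers with p prime, and let c ∈ ℂ. Then the filled Julia set K_c of the correspondence f_c(z) = z^{p/q} + c is either connected or a Cantor set (nonempty, compact, perfect and totally disconnected). -/
/-- A forward orbit of the correspondence `f_c(z) = z^{p/q} + c`, i.e. a sequence
with `(z_{n+1} − c)^q = z_n^p` for all `n`. -/
def IsFwdOrbit (p q : ℕ) (c : ℂ) (z : ℕ → ℂ) : Prop :=
  ∀ n : ℕ, (z (n + 1) - c) ^ q = (z n) ^ p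

/-- The filled Julia set of the correspondence `f_c(z) = z^{p/q} + c`: the set of
points admitting at least one bounded forward orbit. -/
def filledJulia (p q : ℕ) (c : ℂ) : Set ℂ :=
  {z | ∃ s : ℕ → ℂ, s 0 = z ∧ IsFwdOrbit p q c s ∧ Bornology.IsBounded (Set.range s)}

/-- A Cantor set in `ℂ`: nonempty, compact, perfect and totally disconnected. -/
def IsCantorSet (K : Set ℂ) : Prop :=
  K.Nonempty ∧ IsCompact K ∧ Perfect K ∧ IsTotallyDisconnected K

namespace FJ
open Set Filter Topology Complex Metric



lemma arg_range {g : ℝ → ℝ} (hg : Continuous g) (h : ∀ u, 0 ≤ Real.sin (g u)) {u₀ : ℝ}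
    (h0 : g u₀ = 0) (u : ℝ) : 0 ≤ g u ∧ g u ≤ Real.pi := by
  have hpi := Real.pi_pos
  constructor
  · by_contra! hlt
    obtain ⟨v, hv⟩ := mem_range_of_exists_le_of_exists_ge (c := max (g u) (-(Real.pi/2))) hg
      ⟨u, le_max_left _ _⟩ ⟨u₀, by rw [h0]; exact max_le hlt.le (by linarith)⟩
    have := h v
    have h1 : g v < 0 := by rw [hv]; exact max_lt hlt (by linarith)
    have h2 : -Real.pi < g v := by rw [hv]; exact lt_of_lt_of_le (by linarith) (le_max_right _ _)
    have := Real.sin_neg_of_neg_of_neg_pi_lt h1 h2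
    linarith
  · by_contra! hlt
    obtain ⟨v, hv⟩ := mem_range_of_exists_le_of_exists_ge (c := min (g u) (3*Real.pi/2)) hg
      ⟨u₀, by rw [h0]; exact le_min (by linarith) (by linarith)⟩ ⟨u, min_le_left _ _⟩
    have := h v
    have h1 : Real.pi < g v := by rw [hv]; exact lt_min hlt (by linarith)
    have h2 : g v ≤ 3*Real.pi/2 := by rw [hv]; exact min_le_right _ _
    have := Real.sin_neg_of_neg_of_neg_pi_lt (x := g v - 2 * Real.pi) (by linarith) (by linarith)
    rw [Real.sin_sub_two_pi] at this
    linarith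

lemma diag_lift {f : ℝ × ℝ → ℂ} (hf : Continuous f) (h0 : ∀ x, f x ≠ 0) (h1 : ∀ s, f (s, s) = 1) :
    ∃ F : ℝ × ℝ → ℂ, Continuous F ∧ (∀ x, exp (F x) = f x) ∧ ∀ s, F (s, s) = 0 := by
  obtain ⟨F, ⟨hF0, hF⟩, -⟩ := isCoveringMapOn_exp.existsUnique_continuousMap_lifts
    (⟨f, hf⟩ : C(ℝ × ℝ, ℂ)) (a₀ := (0, 0)) (e₀ := 0) (by simp [h1]) (fun a => h0 a)
  have hF' : ∀ x, exp (F x) = f x := fun x => congrFun hF x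
  refine ⟨F, F.continuous, hF', ?_⟩
  have key : ∀ s, ∃ n : ℤ, F (s, s) = n * (2 * Real.pi * I) := by
    intro s
    have := hF' (s, s)
    rw [h1, Complex.exp_eq_one_iff] at this
    exact this
  have hre : ∀ s, ∃ n : ℤ, (F (s, s)).im / (2 * Real.pi) = n := by
    intro s
    obtain ⟨n, hn⟩ := key s
    refine ⟨n, ?_⟩
    rw [hn]
    have := Real.pi_ne_zero
    simp
  choose n hn using hre
  have hc : Continuous (fun s : ℝ => (F (s, s)).im / (2 * Real.pi)) := by
    have := F.continuous
    fun_prop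
  intro s
  have hnc : Continuous n := by
    rw [Int.isClosedEmbedding_coe_real.isEmbedding.continuous_iff]
    convert hc using 1
    ext s; simp [hn]
  have hconst : n s = n 0 := PreconnectedSpace.constant inferInstance hnc
  obtain ⟨k, hk⟩ := key s
  have e0 : (n 0 : ℝ) = 0 := by rw [← hn, hF0]; simp
  have e1 := hn s
  rw [hconst, e0, hk] at e1
  have := Real.pi_ne_zero
  have hk0 : (k : ℝ) = 0 := by
    simpa [this] using e1
  have : k = 0 := by exact_mod_cast hk0
  rw [hk, this]; simp

lemma sin_im_of_exp {F z : ℂ} (h : exp F = z) : (0 ≤ Real.sin F.im ↔ 0 ≤ z.im) ∧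
    (Real.sin F.im ≤ 0 ↔ z.im ≤ 0) := by
  have hp := Real.exp_pos F.re
  rw [← h, Complex.exp_im]
  constructor
  · rw [mul_nonneg_iff_of_pos_left hp]
  · constructor
    · intro h; nlinarith
    · intro h; by_contra! h'; nlinarith [mul_pos hp h']

lemma hopf {L : Set ℂ} (hL : IsPathConnected L) {a b : ℝ} (ha : 0 < a) (hb : 0 < b)
    (h1 : ∀ x ∈ L, ∀ y ∈ L, y - x ≠ a * I) (h2 : ∀ x ∈ L, ∀ y ∈ L, y - x ≠ b * I) :
    ∀ x ∈ L, ∀ y ∈ L, y - x ≠ (a + b) * I := by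
  intro x hx y hy hxy
  obtain ⟨γ₀, hγ₀⟩ := hL.joinedIn x hx y hy
  set γ : ℝ → ℂ := fun t => γ₀.extend t with hγdef
  have hγ : Continuous γ := γ₀.extend.continuous
  have hran : range γ = range γ₀ := γ₀.extend_range
  have hγL : ∀ s, γ s ∈ L := by
    intro s
    have : γ s ∈ range γ := ⟨s, rfl⟩
    rw [hran] at this
    obtain ⟨t, ht⟩ := this
    rw [← ht]; exact hγ₀ t
  have hγ0 : γ 0 = x := γ₀.extend_zero
  have hγ1 : γ 1 = y := γ₀.extend_one
  have hcomp : IsCompact (range γ) := by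
    rw [hran]; exact isCompact_range γ₀.continuous
  obtain ⟨sM, hsM⟩ : ∃ sM, ∀ s, (γ s).re ≤ (γ sM).re := by
    obtain ⟨_, ⟨s, rfl⟩, hs⟩ := hcomp.exists_isMaxOn (range_nonempty γ) continuous_re.continuousOn
    exact ⟨s, fun t => hs ⟨t, rfl⟩⟩
  obtain ⟨sm, hsm⟩ : ∃ sm, ∀ s, (γ sm).re ≤ (γ s).re := by
    obtain ⟨_, ⟨s, rfl⟩, hs⟩ := hcomp.exists_isMinOn (range_nonempty γ) continuous_re.continuousOn
    exact ⟨s, fun t => hs ⟨t, rfl⟩⟩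
  have hac : (a : ℂ) ≠ 0 := by exact_mod_cast ha.ne'
  have hbc : (b : ℂ) ≠ 0 := by exact_mod_cast hb.ne'
  obtain ⟨A, hA, hAe, hAd⟩ := diag_lift (f := fun x => 1 + I * (γ x.2 - γ x.1) / a) (by fun_prop)
    (by
      intro x hx
      refine h1 _ (hγL x.1) _ (hγL x.2) ?_
      field_simp at hx
      linear_combination (-I) * hx + (γ x.2 - γ x.1) * I_sq) (by simp)
  obtain ⟨B, hB, hBe, hBd⟩ := diag_lift (f := fun x => 1 - I * (γ x.2 - γ x.1) / b) (by fun_prop)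
    (by
      intro x hx
      refine h2 _ (hγL x.2) _ (hγL x.1) ?_
      field_simp at hx
      linear_combination (-I) * hx + (γ x.1 - γ x.2) * I_sq) (by simp)
  have A1 : 0 ≤ (A (0, sM)).im ∧ (A (0, sM)).im ≤ Real.pi := by
    refine arg_range (g := fun u => (A (u, sM)).im) (by fun_prop) ?_ (u₀ := sM) (by simp [hAd]) 0
    intro u
    rw [(sin_im_of_exp (hAe _)).1]
    have : (1 + I * (γ sM - γ u) / a).im = ((γ sM).re - (γ u).re) / a := by
      rw [add_im, Complex.div_ofReal_im]; simp
    rw [this]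
    exact div_nonneg (sub_nonneg.2 (hsM u)) ha.le
  have A2 : 0 ≤ -(A (0, sm)).im ∧ -(A (0, sm)).im ≤ Real.pi := by
    refine arg_range (g := fun u => -(A (u, sm)).im) (by fun_prop) ?_ (u₀ := sm) (by simp [hAd]) 0
    intro u
    rw [Real.sin_neg, neg_nonneg, (sin_im_of_exp (hAe _)).2]
    have : (1 + I * (γ sm - γ u) / a).im = ((γ sm).re - (γ u).re) / a := by
      rw [add_im, Complex.div_ofReal_im]; simp
    rw [this]
    exact div_nonpos_of_nonpos_of_nonneg (sub_nonpos.2 (hsm u)) ha.le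
  have B1 : 0 ≤ -(B (1, sM)).im ∧ -(B (1, sM)).im ≤ Real.pi := by
    refine arg_range (g := fun u => -(B (u, sM)).im) (by fun_prop) ?_ (u₀ := sM) (by simp [hBd]) 1
    intro u
    rw [Real.sin_neg, neg_nonneg, (sin_im_of_exp (hBe _)).2]
    have : (1 - I * (γ sM - γ u) / b).im = -(((γ sM).re - (γ u).re) / b) := by
      rw [sub_im, Complex.div_ofReal_im]; simp
    rw [this]
    exact neg_nonpos.2 (div_nonneg (sub_nonneg.2 (hsM u)) hb.le)
  have B2 : 0 ≤ (B (1, sm)).im ∧ (B (1, sm)).im ≤ Real.pi := by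
    refine arg_range (g := fun u => (B (u, sm)).im) (by fun_prop) ?_ (u₀ := sm) (by simp [hBd]) 1
    intro u
    rw [(sin_im_of_exp (hBe _)).1]
    have : (1 - I * (γ sm - γ u) / b).im = -(((γ sm).re - (γ u).re) / b) := by
      rw [sub_im, Complex.div_ofReal_im]; simp
    rw [this]
    exact neg_nonneg.2 (div_nonpos_of_nonpos_of_nonneg (sub_nonpos.2 (hsm u)) hb.le)
  have hcos : ∀ s, exp (A (0, s)) * a = - (exp (B (1, s)) * b) := by
    intro s
    rw [hAe, hBe]
    simp only [hγ0, hγ1]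
    field_simp
    linear_combination I * hxy + (a + b) * I_sq
  have key : ∀ s, Real.cos ((A (0, s)).im - (B (1, s)).im) < 0 := by
    intro s
    have e : exp (A (0, s) - B (1, s)) = ((-(b / a) : ℝ) : ℂ) := by
      rw [Complex.exp_sub]
      have := Complex.exp_ne_zero (B (1, s))
      have := hcos s
      push_cast
      field_simp
      linear_combination this
    have e2 := congrArg Complex.re e
    rw [Complex.exp_re, Complex.ofReal_re, Complex.sub_im] at e2
    have := Real.exp_pos (A (0, s) - B (1, s)).re
    have : 0 < b / a := by positivity
    by_contra! hcon
    nlinarith [mul_nonneg (Real.exp_pos (A (0, s) - B (1, s)).re).le hcon]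
  have hz : ∃ s, (A (0, s)).im - (B (1, s)).im = 0 := by
    exact mem_range_of_exists_le_of_exists_ge (f := fun s => (A (0, s)).im - (B (1, s)).im)
      (by fun_prop) ⟨sm, by simp; linarith⟩ ⟨sM, by simp; linarith⟩
  obtain ⟨s, hs⟩ := hz
  have := key s
  rw [hs, Real.cos_zero] at this
  linarith

inductive Words {ι : Type} (g : ι → ℂ → ℂ) : ℕ → (ℂ → ℂ) → Prop
  | nil : Words g 0 id
  | cons (j : ι) (n : ℕ) (h : ℂ → ℂ) : Words g n h → Words g (n + 1) (g j ∘ h)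

lemma Words.mapsTo {ι : Type} {g : ι → ℂ → ℂ} {A : Set ℂ} (hg : ∀ j, MapsTo (g j) A A) {n : ℕ}
    {h : ℂ → ℂ} (hw : Words g n h) : MapsTo h A A := by
  induction hw with
  | nil => exact mapsTo_id _
  | cons j n h _ ih => exact (hg j).comp ih

lemma Words.injOn {ι : Type} {g : ι → ℂ → ℂ} {A : Set ℂ} (hg : ∀ j, MapsTo (g j) A A)
    (hi : ∀ j, InjOn (g j) A) {n : ℕ}
    {h : ℂ → ℂ} (hw : Words g n h) : InjOn h A := by
  induction hw with
  | nil => exact injOn_id _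
  | cons j n h h' ih => exact (hi j).comp ih (h'.mapsTo hg)

lemma Words.diff {ι : Type} {g : ι → ℂ → ℂ} {A : Set ℂ} (hg : ∀ j, MapsTo (g j) A A)
    (hi : ∀ j, DifferentiableOn ℂ (g j) A) {n : ℕ}
    {h : ℂ → ℂ} (hw : Words g n h) : DifferentiableOn ℂ h A := by
  induction hw with
  | nil => exact differentiableOn_id
  | cons j n h h' ih => exact (hi j).comp ih (h'.mapsTo hg)

lemma deriv_bound {ι : Type} {g : ι → ℂ → ℂ} {U : Set ℂ} (hU : IsOpen U)
    (hg : ∀ j, MapsTo (g j) U U) (hd : ∀ j, DifferentiableOn ℂ (g j) U) {δ : ℝ} (hδ : 0 < δ)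
    (hE : ∀ j, ∀ x ∈ U, ∀ y ∈ U, g j x + δ * (g j x - g j y) ∈ U)
    {x : ℂ} {r : ℝ} (hr : 0 < r) (hx : closedBall x r ⊆ U) {n : ℕ} {h : ℂ → ℂ}
    (hw : Words g n h) :
    ∀ f : ℂ → ℂ, DifferentiableOn ℂ f U → (∀ z ∈ U, ‖f z‖ ≤ 1) →
      ‖deriv (f ∘ h) x‖ ≤ 1 / r * ((1 + δ)⁻¹) ^ n := by
  have hxU : x ∈ U := hx (mem_closedBall_self hr.le)
  induction hw with
  | nil =>
    intro f hf hf1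
    simp only [Function.comp_id, pow_zero, mul_one]
    refine norm_deriv_le_of_forall_mem_sphere_norm_le hr ?_ fun z hz =>
      hf1 z (hx (sphere_subset_closedBall hz))
    exact (hf.mono hx).diffContOnCl_ball Subset.rfl
  | cons j n h hw ih =>
    intro f hf hf1
    have hy : h x ∈ U := hw.mapsTo hg hxU
    set k : ℂ → ℂ := fun z => g j z + δ * (g j z - g j (h x)) with hk
    have hkU : MapsTo k U U := fun z hz => hE j z hz _ hy
    have hkd : DifferentiableOn ℂ k U := by
      have := hd j
      fun_prop
    have := ih (f ∘ k) (hf.comp hkd hkU) (fun z hz => hf1 _ (hkU hz))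
    have hhd : DifferentiableAt ℂ h x := (hw.diff hg hd).differentiableAt (hU.mem_nhds hxU)
    have hgd : DifferentiableAt ℂ (g j) (h x) := (hd j).differentiableAt (hU.mem_nhds hy)
    have hkx : k (h x) = g j (h x) := by simp [hk]
    have hfd : DifferentiableAt ℂ f (g j (h x)) :=
      hf.differentiableAt (hU.mem_nhds (hg j hy))
    have hkdx : HasDerivAt k ((1 + δ) * deriv (g j) (h x)) (h x) := by
      have := hgd.hasDerivAt.add ((hgd.hasDerivAt.sub_const (g j (h x))).const_mul (δ : ℂ))
      exact this.congr_deriv (by ring)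
    have d1 : HasDerivAt (f ∘ k ∘ h) (deriv f (g j (h x)) * ((1 + δ) * deriv (g j) (h x) *
        deriv h x)) x := by
      refine HasDerivAt.comp x ?_ (hkdx.comp x hhd.hasDerivAt)
      simp only [Function.comp, hkx]; exact hfd.hasDerivAt
    have d2 : HasDerivAt (f ∘ g j ∘ h) (deriv f (g j (h x)) * (deriv (g j) (h x) *
        deriv h x)) x :=
      HasDerivAt.comp x hfd.hasDerivAt (hgd.hasDerivAt.comp x hhd.hasDerivAt)
    rw [Function.comp_assoc, d1.deriv] at this
    rw [d2.deriv]
    have e : deriv f (g j (h x)) * ((1 + δ) * deriv (g j) (h x) * deriv h x) =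
      ((1 + δ : ℝ) : ℂ) * (deriv f (g j (h x)) * (deriv (g j) (h x) * deriv h x)) := by
      push_cast; ring
    rw [e, norm_mul, Complex.norm_real, Real.norm_of_nonneg (by positivity)] at this
    have e3 : 1 / r * (1 + δ)⁻¹ ^ (n + 1) = (1 / r * (1 + δ)⁻¹ ^ n) / (1 + δ) := by
      rw [pow_succ, div_eq_mul_inv _ (1 + δ)]; ring
    rw [e3, le_div_iff₀ (by positivity), mul_comm]
    exact this

lemma contraction {ι : Type} {g : ι → ℂ → ℂ} {U : Set ℂ} (hU : IsOpen U)
    (hUc : IsPreconnected U)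
    (hg : ∀ j, MapsTo (g j) U U) (hd : ∀ j, DifferentiableOn ℂ (g j) U) {δ : ℝ} (hδ : 0 < δ)
    (hE : ∀ j, ∀ x ∈ U, ∀ y ∈ U, g j x + δ * (g j x - g j y) ∈ U)
    {R : ℝ} (hR : 0 < R) (hUR : ∀ z ∈ U, ‖z‖ ≤ R) {K : Set ℂ} (hK : IsCompact K) (hKU : K ⊆ U)
    {ε : ℝ} (hε : 0 < ε) :
    ∃ n, ∀ h, Words g n h → ∀ x ∈ K, ∀ y ∈ K, ‖h x - h y‖ ≤ ε := by
  have hδ1 : (1 + δ)⁻¹ < 1 := inv_lt_one_of_one_lt₀ (by linarith)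
  have loc : ∀ x ∈ U, ∃ t ∈ 𝓝 x, ∀ ε > 0, ∀ᶠ n in atTop, ∀ h, Words g n h → ∀ y ∈ t,
      ‖h y - h x‖ ≤ ε := by
    intro x hx
    obtain ⟨r, hr, hrU⟩ := Metric.isOpen_iff.1 hU x hx
    have hr3 : 0 < r / 3 := by positivity
    refine ⟨ball x (r / 3), ball_mem_nhds _ hr3, ?_⟩
    intro ε hε
    have hlim : Tendsto (fun n : ℕ => (R * (1 / (r / 3))) * ((1 + δ)⁻¹) ^ n * (r / 3)) atTop
        (𝓝 0) := by
      have := (tendsto_pow_atTop_nhds_zero_of_lt_one (r := (1 + δ)⁻¹) (by positivity) hδ1)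
      simpa using (this.const_mul (R * (1 / (r / 3)))).mul_const (r / 3)
    filter_upwards [hlim.eventually (gt_mem_nhds hε)] with n hn h hw y hy
    refine le_trans ?_ hn.le
    have hyb : ‖y - x‖ ≤ r / 3 := by
      rw [← dist_eq_norm]; exact (mem_ball.1 hy).le
    refine le_trans ?_ (mul_le_mul_of_nonneg_left hyb (by positivity))
    have hsub : ∀ z ∈ ball x (r / 3), closedBall z (r / 3) ⊆ U := by
      intro z hz w hw
      apply hrU
      rw [mem_ball] at *
      rw [mem_closedBall] at hw
      linarith [dist_triangle w z x]
    have hdz : ∀ z ∈ ball x (r / 3), DifferentiableAt ℂ h z := fun z hz =>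
      (hw.diff hg hd).differentiableAt (hU.mem_nhds (hsub z hz (mem_closedBall_self hr3.le)))
    refine Convex.norm_image_sub_le_of_norm_deriv_le (s := ball x (r / 3)) hdz ?_
      (convex_ball _ _) (mem_ball_self hr3) hy
    intro z hz
    have := deriv_bound hU hg hd hδ hE hr3 (hsub z hz) hw (fun w => w / R) (by fun_prop)
      (by
        intro w hw
        rw [norm_div, Complex.norm_real, Real.norm_of_nonneg hR.le, div_le_one hR]
        exact hUR w hw)
    have e : deriv ((fun w : ℂ => w / R) ∘ h) z = deriv h z / R :=
      ((hdz z hz).hasDerivAt.div_const (R : ℂ)).deriv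
    rw [e, norm_div, Complex.norm_real, Real.norm_of_nonneg hR.le, div_le_iff₀ hR] at this
    linarith
  have pt : ∀ x ∈ U, ∀ y ∈ U, ∀ ε > 0, ∀ᶠ n in atTop, ∀ h, Words g n h → ‖h y - h x‖ ≤ ε := by
    intro x hx y hy
    refine hUc.induction₂ (fun x y => ∀ ε > 0, ∀ᶠ n in atTop, ∀ h, Words g n h → ‖h y - h x‖ ≤ ε)
      ?_ ?_ ?_ hx hy
    · intro x hx
      obtain ⟨t, ht, h⟩ := loc x hx
      filter_upwards [mem_nhdsWithin_of_mem_nhds ht] with y hy ε hε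
      filter_upwards [h ε hε] with n hn h hw using hn h hw y hy
    · intro x y z _ _ _ h1 h2 ε hε
      filter_upwards [h1 (ε / 2) (by positivity), h2 (ε / 2) (by positivity)] with n a b h hw
      have := norm_add_le (h z - h y) (h y - h x)
      rw [sub_add_sub_cancel] at this
      linarith [a h hw, b h hw]
    · intro x y _ _ h1 ε hε
      filter_upwards [h1 ε hε] with n a h hw
      rw [norm_sub_rev]; exact a h hw
  rcases K.eq_empty_or_nonempty with rfl | ⟨x₀, hx₀⟩
  · exact ⟨0, by simp⟩
  have main : ∀ ε > 0, ∀ᶠ n in atTop, ∀ h, Words g n h → ∀ y ∈ K, ‖h y - h x₀‖ ≤ ε := by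
    refine hK.induction_on (p := fun s => ∀ ε > 0, ∀ᶠ n in atTop, ∀ h, Words g n h → ∀ y ∈ s,
      ‖h y - h x₀‖ ≤ ε) (by simp) ?_ ?_ ?_
    · intro s t hst h ε hε
      filter_upwards [h ε hε] with n a h hw y hy using a h hw y (hst hy)
    · intro s t h1 h2 ε hε
      filter_upwards [h1 ε hε, h2 ε hε] with n a b h hw y hy
      exact hy.elim (a h hw y) (b h hw y)
    · intro x hx
      obtain ⟨t, ht, h⟩ := loc x (hKU hx)
      refine ⟨t, mem_nhdsWithin_of_mem_nhds ht, fun ε hε => ?_⟩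
      filter_upwards [h (ε / 2) (by positivity), pt x₀ (hKU hx₀) x (hKU hx) (ε / 2)
        (by positivity)] with n a b h hw y hy
      have := norm_add_le (h y - h x) (h x - h x₀)
      rw [sub_add_sub_cancel] at this
      linarith [a h hw y hy, b h hw]
  obtain ⟨n, hn⟩ := (main (ε / 2) (by positivity)).exists
  refine ⟨n, fun h hw x hx y hy => ?_⟩
  have := norm_sub_le (h x - h x₀) (h y - h x₀)
  rw [sub_sub_sub_cancel_right] at this
  linarith [hn h hw x hx, hn h hw y hy]

def preC (p q : ℕ) (c : ℂ) (A : Set ℂ) : Set ℂ := {z | ∃ w ∈ A, (w - c) ^ q = z ^ p}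

lemma preC_eq (p q : ℕ) (c : ℂ) (A : Set ℂ) :
    preC p q c A = (fun z : ℂ => z ^ p) ⁻¹' ((fun w : ℂ => (w - c) ^ q) '' A) := by
  ext z; simp [preC]

lemma isOpenMap_P {q : ℕ} (hq : 1 ≤ q) (c : ℂ) : IsOpenMap (fun w : ℂ => (w - c) ^ q) := by
  have : NeZero q := ⟨by omega⟩
  exact (Complex.isOpenQuotientMap_pow q).isOpenMap.comp (Homeomorph.subRight c).isOpenMap

lemma isClosedMap_powC {p : ℕ} (hp : 0 < p) : IsClosedMap (fun w : ℂ => w ^ p) := by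
  have := (Polynomial.isProperMap_eval (R := ℂ) (Polynomial.X ^ p) (by simpa using hp)).isClosedMap
  simpa using this

lemma preC_isOpen {p q : ℕ} (hq : 1 ≤ q) (c : ℂ) {A : Set ℂ} (hA : IsOpen A) :
    IsOpen (preC p q c A) := by
  rw [preC_eq]
  exact (isOpenMap_P hq c A hA).preimage (by fun_prop)

lemma preC_preconn_of_mem {p q : ℕ} (hp : 0 < p) (hq : 1 ≤ q) (c : ℂ) {U : Set ℂ}
    (hUo : IsOpen U) (hU : IsPreconnected U) (hc : c ∈ U) : IsPreconnected (preC p q c U) := by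
  have h0 : (0 : ℂ) ∈ preC p q c U := ⟨c, hc, by
    rw [sub_self, zero_pow (by omega), zero_pow (by omega)]⟩
  have hpz : NeZero p := ⟨by omega⟩
  have claim : ∀ u v : Set ℂ, IsOpen u → IsOpen v → preC p q c U ⊆ u ∪ v →
      preC p q c U ∩ (u ∩ v) = ∅ → (0 : ℂ) ∈ u → preC p q c U ⊆ u := by
    intro u v hu hv hcov hdis h0u
    by_contra hcon
    obtain ⟨z, hz, hzu⟩ := not_subset.1 hcon
    have hzv : z ∈ v := (hcov hz).resolve_left hzu
    have hB : IsPreconnected ((fun w : ℂ => (w - c) ^ q) '' U) :=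
      hU.image _ (by fun_prop)
    have hroots : ∀ b ∈ (fun w : ℂ => (w - c) ^ q) '' U, ∀ x : ℂ, x ^ p = b → x ∈ preC p q c U := by
      rintro b ⟨w, hw, rfl⟩ x hx
      exact ⟨w, hw, hx.symm⟩
    obtain ⟨b, hb, ⟨⟨x, ⟨hx1, hx2⟩, rfl⟩, hb2⟩⟩ := hB
      ((fun z : ℂ => z ^ p) '' (preC p q c U ∩ v)) ((fun z : ℂ => z ^ p) '' uᶜ)ᶜ
      ((Complex.isOpenQuotientMap_pow p).isOpenMap _ ((preC_isOpen hq c hUo).inter hv))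
      (isClosedMap_powC hp _ hu.isClosed_compl).isOpen_compl
      (by
        intro b hb
        by_cases h : b ∈ (fun z : ℂ => z ^ p) '' uᶜ
        · left
          obtain ⟨x, hx, rfl⟩ := h
          have := hroots _ hb x rfl
          exact ⟨x, ⟨this, (hcov this).resolve_left hx⟩, rfl⟩
        · exact Or.inr h)
      (by
        obtain ⟨w, hw, hwz⟩ := hz
        exact ⟨z ^ p, ⟨w, hw, hwz⟩, ⟨z, ⟨⟨w, hw, hwz⟩, hzv⟩, rfl⟩⟩)
      ⟨0, ⟨c, hc, by simp; omega⟩, by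
        rintro ⟨x, hx, hx0⟩
        have : x = 0 := by
          simpa [hp.ne'] using hx0
        exact hx (this ▸ h0u)⟩
    have hxu : x ∈ u := by
      by_contra h
      exact hb2 ⟨x, h, rfl⟩
    have : x ∈ preC p q c U ∩ (u ∩ v) := ⟨hx1, hxu, hx2⟩
    rw [hdis] at this
    exact this
  rw [isPreconnected_iff_subset_of_disjoint]
  intro u v hu hv hcov hdis
  rcases hcov h0 with h | h
  · exact Or.inl (claim u v hu hv hcov hdis h)
  · exact Or.inr (claim v u hv hu (by rwa [union_comm]) (by rwa [inter_comm v u]) h)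

lemma exists_log_component {c : ℂ} {U : Set ℂ} (hUo : IsOpen U) (hU : IsConnected U)
    (hc : c ∉ U) : ∃ L : Set ℂ, IsOpen L ∧ IsConnected L ∧ (∀ x ∈ L, exp x + c ∈ U) ∧
      ∀ w ∈ U, ∃ x ∈ L, exp x + c = w := by
  set V : Set ℂ := {x | exp x + c ∈ U} with hV
  have hVo : IsOpen V := hUo.preimage (by fun_prop)
  have hlog : ∀ w ∈ U, ∃ x, exp x + c = w := by
    intro w hw
    have : w - c ≠ 0 := by
      intro h
      rw [sub_eq_zero] at h
      exact hc (h ▸ hw)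
    exact ⟨log (w - c), by rw [exp_log this]; ring⟩
  obtain ⟨w₀, hw₀⟩ := hU.nonempty
  obtain ⟨x₀, hx₀⟩ := hlog w₀ hw₀
  have hx₀V : x₀ ∈ V := by simpa [hV, hx₀] using hw₀
  have htr : ∀ x ∈ V, ∀ t : ℂ, exp t = 1 → ∀ y ∈ connectedComponentIn V x,
      y + t ∈ connectedComponentIn V (x + t) := by
    intro x hx t ht y hy
    have : (fun y => y + t) '' connectedComponentIn V x ⊆ connectedComponentIn V (x + t) := by
      apply IsPreconnected.subset_connectedComponentIn
      · exact isPreconnected_connectedComponentIn.image _ (by fun_prop)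
      · exact ⟨x, mem_connectedComponentIn hx, rfl⟩
      · rintro _ ⟨z, hz, rfl⟩
        have : z ∈ V := connectedComponentIn_subset _ _ hz
        simpa [hV, exp_add, ht] using this
    exact this ⟨y, hy, rfl⟩
  refine ⟨connectedComponentIn V x₀, hVo.connectedComponentIn,
    isConnected_connectedComponentIn_iff.2 hx₀V,
    fun x hx => (connectedComponentIn_subset V x₀ hx : x ∈ V), ?_⟩
  set Q : ℂ → Prop := fun w => ∃ x ∈ connectedComponentIn V x₀, exp x + c = w with hQ
  have main : ∀ w ∈ U, (Q w₀ ↔ Q w) := by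
    intro w hw
    refine hU.isPreconnected.induction₂ (fun w w' => (Q w ↔ Q w')) ?_ ?_ ?_ hw₀ hw
    · intro w hw
      obtain ⟨x, hx⟩ := hlog w hw
      have hxV : x ∈ V := by simpa [hV, hx] using hw
      have hnb : (fun x => exp x + c) '' connectedComponentIn V x ∈ 𝓝 w := by
        have ho : IsOpenMap (fun x => exp x + c) :=
          (Homeomorph.addRight c).isOpenMap.comp isOpenMap_exp
        rw [← hx]
        exact ho.image_mem_nhds (hVo.connectedComponentIn.mem_nhds (mem_connectedComponentIn hxV))
      filter_upwards [mem_nhdsWithin_of_mem_nhds hnb]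
      rintro w' ⟨x', hx', rfl⟩
      have hx'V : x' ∈ V := connectedComponentIn_subset _ _ hx'
      have hexp : ∀ a b : ℂ, exp a + c = exp b + c → exp (a - b) = 1 := by
        intro a b hab
        rw [exp_sub, add_right_cancel hab, div_self (exp_ne_zero _)]
      have tr1 : ∀ a ∈ V, ∀ b ∈ connectedComponentIn V a, Q (exp a + c) → Q (exp b + c) := by
        rintro a ha b hb ⟨y, hy, hya⟩
        have ht := hexp y a hya
        have := htr a ha _ ht b hb
        rw [add_sub_cancel, ← connectedComponentIn_eq hy] at this
        exact ⟨_, this, by rw [exp_add, ht, mul_one]⟩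
      constructor
      · rw [← hx]
        exact tr1 x hxV x' hx'
      · rw [← hx]
        refine tr1 x' hx'V x ?_
        rw [← connectedComponentIn_eq hx']
        exact mem_connectedComponentIn hxV
    · intro x y z _ _ _ h1 h2; exact h1.trans h2
    · intro x y _ _ h; exact h.symm
  intro w hw
  exact (main w hw).1 ⟨x₀, mem_connectedComponentIn hx₀V, hx₀⟩

lemma chord_connected {p q : ℕ} (hp : p.Prime) (hq : 1 ≤ q) {c : ℂ} {U L : Set ℂ}
    (hL : IsConnected L) (hLU : ∀ x ∈ L, exp x + c ∈ U) (hLs : ∀ w ∈ U, ∃ x ∈ L, exp x + c = w)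
    {j : ℕ} (hj : ¬ p ∣ j) {x y : ℂ} (hx : x ∈ L) (hy : y ∈ L)
    (hxy : y - x = ((2 * Real.pi * j / q : ℝ) : ℂ) * I) : IsPreconnected (preC p q c U) := by
  have hq0 : (q : ℂ) ≠ 0 := by exact_mod_cast (by omega : q ≠ 0)
  have hp0 : (p : ℂ) ≠ 0 := by exact_mod_cast hp.ne_zero
  have hpp := Fact.mk hp
  set ξ : ℂ := exp (2 * Real.pi * I * j / p) with hξ
  have hξp : ξ ^ p = 1 := by
    rw [hξ, ← exp_nat_mul, exp_eq_one_iff]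
    exact ⟨j, by push_cast; field_simp⟩
  have hξ1 : ξ ≠ 1 := by
    intro h
    rw [hξ, exp_eq_one_iff] at h
    obtain ⟨n, hn⟩ := h
    have hpi : (Real.pi : ℂ) ≠ 0 := by exact_mod_cast Real.pi_ne_zero
    have hI := I_ne_zero
    have : (j : ℂ) = n * p := by
      field_simp at hn
      linear_combination hn
    have h2 : (j : ℤ) = n * p := by exact_mod_cast this
    apply hj
    exact Int.natCast_dvd_natCast.1 ⟨n, by rw [h2]; ring⟩
  have hprim : IsPrimitiveRoot ξ p := IsPrimitiveRoot.iff_orderOf.2 (orderOf_eq_prime hξp hξ1)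
  set E : ℂ → ℂ := fun x => exp (q * x / p) with hE
  have hEp : ∀ x, E x ^ p = exp x ^ q := by
    intro x
    rw [hE, ← exp_nat_mul, ← exp_nat_mul]
    congr 1; field_simp
  have hEy : E y = ξ * E x := by
    rw [hE, hξ, ← exp_add]
    congr 1
    rw [sub_eq_iff_eq_add] at hxy
    rw [hxy]; push_cast; field_simp
  have heq : preC p q c U = ⋃ n : ℕ, (fun x => ξ ^ n * E x) '' L := by
    ext z
    simp only [mem_iUnion, mem_image]
    constructor
    · rintro ⟨w, hw, hwz⟩
      obtain ⟨x, hx, rfl⟩ := hLs w hw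
      rw [add_sub_cancel_right] at hwz
      have hE0 : E x ≠ 0 := exp_ne_zero _
      have : (z / E x) ^ p = 1 := by
        rw [div_pow, hEp, hwz, div_self]
        rw [← hwz]; exact pow_ne_zero _ (exp_ne_zero _)
      obtain ⟨i, -, hi⟩ := hprim.eq_pow_of_pow_eq_one this
      exact ⟨i, x, hx, by rw [hi]; field_simp⟩
    · rintro ⟨n, x, hx, rfl⟩
      refine ⟨exp x + c, hLU x hx, ?_⟩
      rw [add_sub_cancel_right, mul_pow, hEp, ← pow_mul, mul_comm n, pow_mul, hξp, one_pow, one_mul]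
  rw [heq]
  apply IsPreconnected.iUnion_of_chain
  · intro n
    exact hL.isPreconnected.image _ (by fun_prop)
  · intro n
    refine ⟨ξ ^ n * E y, ⟨y, hy, rfl⟩, x, hx, ?_⟩
    simp only [Order.succ_eq_add_one]
    rw [hEy]; ring

lemma branch {p q : ℕ} (hp : p.Prime) (hq : 1 ≤ q) {c : ℂ} {U : Set ℂ}
    (hUo : IsOpen U) (hU : IsConnected U) (hdis : ¬ IsPreconnected (preC p q c U)) :
    c ∉ U ∧ InjOn (fun w => (w - c) ^ q) U ∧
      ∃ G : ℂ → ℂ, DifferentiableOn ℂ G U ∧ ∀ w ∈ U, G w ^ p = (w - c) ^ q := by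
  have hc : c ∉ U := fun h => hdis (preC_preconn_of_mem hp.pos hq c hUo hU.isPreconnected h)
  obtain ⟨L, hLo, hL, hLU, hLs⟩ := exists_log_component hUo hU hc
  have hq0 : (q : ℂ) ≠ 0 := by exact_mod_cast (by omega : q ≠ 0)
  have hqr : (0 : ℝ) < q := by exact_mod_cast hq
  have hp0 : (p : ℂ) ≠ 0 := by exact_mod_cast hp.ne_zero
  have hpi := Real.pi_pos
  have NC : ∀ j : ℕ, ¬ p ∣ j → ∀ x ∈ L, ∀ y ∈ L, y - x ≠ ((2 * Real.pi * j / q : ℝ) : ℂ) * I :=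
    fun j hj x hx y hy h => hdis (chord_connected hp hq hL hLU hLs hj hx hy h)
  have NCk : ∀ k : ℕ, 0 < k → ∀ x ∈ L, ∀ y ∈ L, y - x ≠ ((2 * Real.pi * k / q : ℝ) : ℂ) * I := by
    intro k hk
    by_cases hpk : p ∣ k
    · have hp2 := hp.two_le
      have hkp : p ≤ k := Nat.le_of_dvd hk hpk
      have hk1 : ¬ p ∣ (k - 1) := by
        intro h
        have := (Nat.dvd_sub hpk h)
        rw [Nat.sub_sub_self hk] at this
        have := Nat.le_of_dvd one_pos this
        omega
      have h1 : ¬ p ∣ 1 := fun h => by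
        have := Nat.le_of_dvd one_pos h
        omega
      have hk1r : (0 : ℝ) < ((k - 1 : ℕ) : ℝ) := by
        exact_mod_cast (by omega : 0 < k - 1)
      have := hopf (hLo.isConnected_iff_isPathConnected.1 hL)
        (a := 2 * Real.pi * (1 : ℕ) / q) (b := 2 * Real.pi * (k - 1 : ℕ) / q)
        (by push_cast; positivity) (by positivity) (NC 1 h1) (NC _ hk1)
      intro x hx y hy hxy
      refine this x hx y hy ?_
      rw [hxy]
      push_cast [Nat.cast_sub hk]
      ring
    · exact NC k hpk
  have inj : ∀ x ∈ L, ∀ y ∈ L, exp x ^ q = exp y ^ q → x = y := by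
    intro x hx y hy h
    rw [← exp_nat_mul, ← exp_nat_mul, exp_eq_exp_iff_exists_int] at h
    obtain ⟨n, hn⟩ := h
    have e : x - y = ((2 * Real.pi * n / q : ℝ) : ℂ) * I := by
      push_cast; field_simp; linear_combination hn
    rcases lt_trichotomy n 0 with h | h | h
    · exfalso
      lift -n to ℕ using by omega with k hk
      refine NCk k (by omega) x hx y hy ?_
      have : (k : ℝ) = -(n : ℝ) := by exact_mod_cast hk
      rw [this]
      push_cast at e ⊢
      linear_combination -e
    · rw [h] at e
      simpa [sub_eq_zero] using e
    · exfalso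
      lift n to ℕ using h.le
      exact NCk n (by omega) y hy x hx (by simpa using e)
  refine ⟨hc, ?_, ?_⟩
  · intro w hw w' hw' h
    obtain ⟨x, hx, rfl⟩ := hLs w hw
    obtain ⟨y, hy, rfl⟩ := hLs w' hw'
    simp only [add_sub_cancel_right] at h
    rw [inj x hx y hy h]
  · have : ∀ w, ∃ x, w ∈ U → x ∈ L ∧ exp x + c = w := by
      intro w
      by_cases hw : w ∈ U
      · obtain ⟨x, hx⟩ := hLs w hw
        exact ⟨x, fun _ => hx⟩
      · exact ⟨0, fun h => absurd h hw⟩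
    choose l hl using this
    have hcont : ∀ w ∈ U, ContinuousAt l w := by
      intro w hw N hN
      obtain ⟨h1, h2⟩ := hl w hw
      have ho : IsOpenMap (fun x => exp x + c) :=
        (Homeomorph.addRight c).isOpenMap.comp isOpenMap_exp
      have := ho.image_mem_nhds (inter_mem hN (hLo.mem_nhds h1))
      simp only [h2] at this
      rw [mem_map]
      filter_upwards [this, hUo.mem_nhds hw]
      rintro w' ⟨x, ⟨hxN, hxL⟩, hxw⟩ hw'
      obtain ⟨h3, h4⟩ := hl w' hw'
      have : l w' = x := inj _ h3 _ hxL (by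
        rw [← h4] at hxw
        rw [add_right_cancel hxw])
      rw [mem_preimage, this]; exact hxN
    have hd : DifferentiableOn ℂ l U := by
      intro w hw
      have : HasDerivAt (fun x => exp x + c) (exp (l w)) (l w) := (hasDerivAt_exp _).add_const c
      exact (HasDerivAt.of_local_left_inverse (hcont w hw) this (exp_ne_zero _)
        (by filter_upwards [hUo.mem_nhds hw] with w' hw' using (hl w' hw').2)).differentiableAt.differentiableWithinAt
    refine ⟨fun w => exp (q * l w / p), by fun_prop, ?_⟩
    intro w hw
    have : w - c = exp (l w) := by
      rw [sub_eq_iff_eq_add]; exact (hl w hw).2.symm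
    rw [this, ← exp_nat_mul, ← exp_nat_mul]
    congr 1; field_simp

lemma cantor_case {p q : ℕ} {c : ℂ} (hp : p.Prime) {U C' K : Set ℂ} {R : ℝ}
    (hUo : IsOpen U) (hU : IsConnected U) (hUR : ∀ z ∈ U, ‖z‖ ≤ R)
    (hC' : IsCompact C') (hUC : preC p q c U ⊆ C') (hCU : C' ⊆ U)
    (hc : c ∉ U) (hinj : InjOn (fun w => (w - c) ^ q) U)
    {G : ℂ → ℂ} (hG : DifferentiableOn ℂ G U) (hGp : ∀ w ∈ U, G w ^ p = (w - c) ^ q)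
    (hK : IsCompact K) (hKne : K.Nonempty) (hKU : K ⊆ U) (hKK : K = preC p q c K) :
    Perfect K ∧ IsTotallyDisconnected K := by
  let g : {ζ : ℂ // ζ ^ p = 1} → ℂ → ℂ := fun ζ w => ζ.1 * G w
  have hgp : ∀ j, ∀ w ∈ U, (g j w) ^ p = (w - c) ^ q := by
    intro j w hw
    simp only [g, mul_pow, j.2, hGp w hw, one_mul]
  have hgC : ∀ j, MapsTo (g j) U C' := fun j w hw => hUC ⟨w, hw, (hgp j w hw).symm⟩
  have hgU : ∀ j, MapsTo (g j) U U := fun j w hw => hCU (hgC j hw)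
  have hgK : ∀ j, MapsTo (g j) K K := fun j w hw => by
    rw [hKK]; exact ⟨w, hw, (hgp j w (hKU hw)).symm⟩
  have hginj : ∀ j, InjOn (g j) U := fun j x hx y hy hxy => by
    apply hinj hx hy
    show (x - c) ^ q = (y - c) ^ q
    rw [← hgp j x hx, ← hgp j y hy, hxy]
  have hgd : ∀ j, DifferentiableOn ℂ (g j) U := fun j => hG.const_mul _
  obtain ⟨x0, hx0⟩ := hU.nonempty
  have hR0 : 0 ≤ R := (norm_nonneg _).trans (hUR x0 hx0)
  obtain ⟨e, he, hthick⟩ := hC'.exists_thickening_subset_open hUo hCU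
  set δ : ℝ := e / (2 * (2 * R + 1)) with hδdef
  have hδ : 0 < δ := by positivity
  have hE : ∀ j, ∀ x ∈ U, ∀ y ∈ U, g j x + δ * (g j x - g j y) ∈ U := by
    intro j x hx y hy
    apply hthick
    rw [mem_thickening_iff]
    refine ⟨g j x, hgC j hx, ?_⟩
    rw [dist_eq_norm, add_sub_cancel_left, norm_mul, Complex.norm_real, Real.norm_of_nonneg hδ.le]
    have h1 : ‖g j x - g j y‖ ≤ 2 * R + 1 := by
      have := norm_sub_le (g j x) (g j y)
      linarith [hUR _ (hgU j hx), hUR _ (hgU j hy)]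
    calc δ * ‖g j x - g j y‖ ≤ δ * (2 * R + 1) := by gcongr
      _ = e / 2 := by rw [hδdef]; field_simp
      _ < e := by linarith
  have hcontr : ∀ ε : ℝ, 0 < ε → ∃ n, ∀ h, Words g n h → ∀ x ∈ K, ∀ y ∈ K, ‖h x - h y‖ ≤ ε := by
    intro ε hε
    exact contraction hUo hU.isPreconnected hgU hgd hδ hE (R := R + 1) (by positivity)
      (fun z hz => (hUR z hz).trans (by linarith)) hK hKU hε
  have hex : ∀ z ∈ K, ∃ w ∈ K, (w - c) ^ q = z ^ p := fun z hz => by rw [hKK] at hz; exact hz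
  choose! φ hφK hφ using hex
  have hφc : ContinuousOn φ K := by
    rw [continuousOn_iff_isClosed]
    intro t ht
    refine ⟨(fun z : ℂ => z ^ p) ⁻¹' ((fun w : ℂ => (w - c) ^ q) '' (t ∩ K)), ?_, ?_⟩
    · apply IsClosed.preimage (by fun_prop)
      exact ((hK.inter_left ht).image (by fun_prop)).isClosed
    · ext z
      constructor
      · rintro ⟨h1, h2⟩
        exact ⟨⟨φ z, ⟨h1, hφK z h2⟩, hφ z h2⟩, h2⟩
      · rintro ⟨⟨w, ⟨hwt, hwK⟩, hw⟩, h2⟩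
        refine ⟨?_, h2⟩
        have : w = φ z := hinj (hKU hwK) (hKU (hφK z h2)) (by
          show (w - c) ^ q = (φ z - c) ^ q
          rw [hφ z h2]; exact hw)
        show φ z ∈ t
        rw [← this]; exact hwt
  have hGne : ∀ w ∈ U, G w ≠ 0 := by
    intro w hw h0
    have h1 := hGp w hw
    rw [h0, zero_pow hp.ne_zero] at h1
    have h2 : w - c = 0 := by
      by_contra h
      exact pow_ne_zero q h h1.symm
    exact hc (by rw [← sub_eq_zero.mp h2]; exact hw)
  have hcov : ∀ n, ∀ X : Set ℂ, IsPreconnected X → X.Nonempty → X ⊆ K →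
      ∃ h, Words g n h ∧ X ⊆ h '' K := by
    intro n
    induction n with
    | zero =>
      intro X _ _ hXK
      exact ⟨id, Words.nil, by simpa using hXK⟩
    | succ n ih =>
      intro X hX hXne hXK
      obtain ⟨h, hh, hsub⟩ := ih (φ '' X) (hX.image φ (hφc.mono hXK)) (hXne.image _)
        (by rintro _ ⟨x, hx, rfl⟩; exact hφK x (hXK hx))
      let r : ℂ → ℂ := fun z => z / G (φ z)
      have hrp : ∀ z ∈ K, r z ^ p = 1 := by
        intro z hz
        have h1 := hGp _ (hKU (hφK z hz))
        have h2 := hGne _ (hKU (hφK z hz))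
        simp only [r, div_pow]
        rw [h1, hφ z hz, div_self]
        rw [← hφ z hz, ← h1]
        exact pow_ne_zero _ h2
      have hrc : ContinuousOn r K := by
        apply continuousOn_id.div
        · exact hG.continuousOn.comp hφc (fun z hz => hKU (hφK z hz))
        · exact fun z hz => hGne _ (hKU (hφK z hz))
      have hfin : {ζ : ℂ | ζ ^ p = 1}.Finite := by
        have : {ζ : ℂ | ζ ^ p = 1} ⊆ ((Polynomial.nthRoots p (1 : ℂ)).toFinset : Set ℂ) := by
          intro ζ hζ
          simp only [Finset.mem_coe, Multiset.mem_toFinset]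
          rw [Polynomial.mem_nthRoots hp.pos]; exact hζ
        exact (Finset.finite_toSet _).subset this
      have hss : (r '' X).Subsingleton := by
        apply hfin.countable.isTotallyDisconnected
        · rintro _ ⟨x, hx, rfl⟩; exact hrp x (hXK hx)
        · exact hX.image r (hrc.mono hXK)
      obtain ⟨x1, hx1⟩ := hXne
      refine ⟨g ⟨r x1, hrp x1 (hXK hx1)⟩ ∘ h, Words.cons _ _ _ hh, ?_⟩
      intro x hx
      obtain ⟨k, hk, hkx⟩ := hsub ⟨x, hx, rfl⟩
      refine ⟨k, hk, ?_⟩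
      have h3 : r x1 = r x := hss ⟨x1, hx1, rfl⟩ ⟨x, hx, rfl⟩
      simp only [Function.comp, g, hkx, h3, r]
      exact div_mul_cancel₀ _ (hGne _ (hKU (hφK x (hXK hx))))
  constructor
  · refine ⟨hK.isClosed, ?_⟩
    intro x hx
    rw [accPt_iff_nhds]
    intro V hV
    obtain ⟨ε, hε, hball⟩ := Metric.mem_nhds_iff.mp hV
    obtain ⟨n, hn⟩ := hcontr (ε / 2) (by positivity)
    obtain ⟨h, hh, hsub⟩ := hcov n {x} isPreconnected_singleton (singleton_nonempty x)
      (singleton_subset_iff.mpr hx)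
    obtain ⟨y, hy, hyx⟩ := hsub rfl
    have hhK : MapsTo h K K := hh.mapsTo hgK
    have hhinj : InjOn h U := hh.injOn hgU hginj
    obtain ⟨k1, hk1⟩ := hKne
    have hk10 : k1 ≠ 0 := by
      rintro rfl
      have h1 := hφ _ hk1
      rw [zero_pow hp.ne_zero] at h1
      have h2 : φ 0 - c = 0 := by
        by_contra h
        exact pow_ne_zero q h h1
      exact hc (by rw [← sub_eq_zero.mp h2]; exact hKU (hφK _ hk1))
    have hprim := Complex.isPrimitiveRoot_exp p hp.ne_zero
    set ζ := Complex.exp (2 * Real.pi * I / p)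
    have hk2 : ζ * k1 ∈ K := by
      rw [hKK]
      refine ⟨φ k1, hφK _ hk1, ?_⟩
      rw [hφ _ hk1, mul_pow, hprim.pow_eq_one, one_mul]
    have hne : ζ * k1 ≠ k1 := by
      intro h
      exact hprim.ne_one hp.one_lt (mul_right_cancel₀ hk10 (by rw [h, one_mul]))
    have key : ∃ k ∈ K, h k ≠ x := by
      by_contra! hcon
      exact hne (hhinj (hKU hk2) (hKU hk1) ((hcon _ hk2).trans (hcon _ hk1).symm))
    obtain ⟨k, hk, hkx⟩ := key
    refine ⟨h k, ⟨hball ?_, hhK hk⟩, hkx⟩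
    rw [mem_ball, dist_eq_norm, ← hyx]
    linarith [hn h hh k hk y hy]
  · intro X hXK hX x hx y hy
    by_contra hxy
    have hpos : 0 < ‖x - y‖ := norm_pos_iff.mpr (sub_ne_zero.mpr hxy)
    obtain ⟨n, hn⟩ := hcontr (‖x - y‖ / 2) (by positivity)
    obtain ⟨h, hh, hsub⟩ := hcov n X hX ⟨x, hx⟩ hXK
    obtain ⟨a, ha, rfl⟩ := hsub hx
    obtain ⟨b, hb, rfl⟩ := hsub hy
    linarith [hn h hh a ha b hb]

section Dyn
variable {p q : ℕ} {c : ℂ}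

lemma preC_mono {A B : Set ℂ} (h : A ⊆ B) : preC p q c A ⊆ preC p q c B :=
  fun _ ⟨w, hw, e⟩ => ⟨w, h hw, e⟩

lemma escape (hq : 1 ≤ q) (hpq : q < p) {z w : ℂ} (hz : 2 ^ q + ‖c‖ + 1 ≤ ‖z‖)
    (h : (w - c) ^ q = z ^ p) : ‖z‖ + 1 ≤ ‖w‖ := by
  have hc := norm_nonneg c
  have h2 : (1 : ℝ) ≤ 2 ^ q := one_le_pow₀ (by norm_num)
  have h1 : ‖w - c‖ ^ q = ‖z‖ ^ p := by rw [← norm_pow, h, norm_pow]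
  have h3 : (2 * ‖z‖) ^ q ≤ ‖w - c‖ ^ q := by
    rw [h1, mul_pow]
    calc (2 : ℝ) ^ q * ‖z‖ ^ q ≤ ‖z‖ * ‖z‖ ^ q := by gcongr; linarith
      _ = ‖z‖ ^ (q + 1) := by ring
      _ ≤ ‖z‖ ^ p := pow_le_pow_right₀ (by linarith) hpq
  have h4 : 2 * ‖z‖ ≤ ‖w - c‖ := le_of_pow_le_pow_left₀ (by omega) (norm_nonneg _) h3
  have := norm_sub_le w c
  linarith

lemma preC_closedBall (hq : 1 ≤ q) (hpq : q < p) :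
    preC p q c (closedBall 0 (2 ^ q + ‖c‖ + 1)) ⊆ ball 0 (2 ^ q + ‖c‖ + 1) := by
  rintro z ⟨w, hw, h⟩
  rw [mem_closedBall_zero_iff] at hw
  rw [mem_ball_zero_iff]
  by_contra! hz
  linarith [escape hq hpq hz h]

lemma preC_nonempty (hp : 0 < p) {A : Set ℂ} (hA : A.Nonempty) : (preC p q c A).Nonempty := by
  obtain ⟨w, hw⟩ := hA
  obtain ⟨z, hz⟩ := IsAlgClosed.exists_pow_nat_eq ((w - c) ^ q) hp
  exact ⟨z, w, hw, hz.symm⟩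

lemma preC_isClosed {A : Set ℂ} (hA : IsCompact A) : IsClosed (preC p q c A) := by
  rw [preC_eq]
  exact IsClosed.preimage (by fun_prop) (hA.image (by fun_prop)).isClosed

def Un (p q : ℕ) (c : ℂ) (n : ℕ) : Set ℂ := (preC p q c)^[n] (ball 0 (2 ^ q + ‖c‖ + 1))
def Cn (p q : ℕ) (c : ℂ) (n : ℕ) : Set ℂ := (preC p q c)^[n] (closedBall 0 (2 ^ q + ‖c‖ + 1))

lemma Un_succ (n : ℕ) : Un p q c (n + 1) = preC p q c (Un p q c n) :=
  Function.iterate_succ_apply' _ _ _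
lemma Cn_succ (n : ℕ) : Cn p q c (n + 1) = preC p q c (Cn p q c n) :=
  Function.iterate_succ_apply' _ _ _

lemma Un_open (hq : 1 ≤ q) (n : ℕ) : IsOpen (Un p q c n) := by
  induction n with
  | zero => exact isOpen_ball
  | succ n ih => rw [Un_succ]; exact preC_isOpen hq c ih

lemma Un_sub_Cn (n : ℕ) : Un p q c n ⊆ Cn p q c n := by
  induction n with
  | zero => exact ball_subset_closedBall
  | succ n ih => rw [Un_succ, Cn_succ]; exact preC_mono ih

lemma Cn_sub_Un (hq : 1 ≤ q) (hpq : q < p) (n : ℕ) : Cn p q c (n + 1) ⊆ Un p q c n := by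
  induction n with
  | zero => rw [Cn_succ]; exact preC_closedBall hq hpq
  | succ n ih => rw [Un_succ, Cn_succ]; exact preC_mono ih

lemma Cn_anti (hq : 1 ≤ q) (hpq : q < p) : Antitone (Cn p q c) :=
  antitone_nat_of_succ_le fun n => (Cn_sub_Un hq hpq n).trans (Un_sub_Cn n)

lemma Cn_compact (hq : 1 ≤ q) (hpq : q < p) (n : ℕ) : IsCompact (Cn p q c n) := by
  induction n with
  | zero => exact isCompact_closedBall _ _
  | succ n ih =>
    rw [Cn_succ]
    refine (isCompact_closedBall (0 : ℂ) (2 ^ q + ‖c‖ + 1)).of_isClosed_subset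
      (preC_isClosed ih) ?_
    rw [← Cn_succ]
    exact Cn_anti hq hpq (Nat.zero_le (n + 1))

lemma Un_nonempty (hp : 0 < p) (n : ℕ) : (Un p q c n).Nonempty := by
  induction n with
  | zero => exact ⟨0, mem_ball_self (by positivity)⟩
  | succ n ih => rw [Un_succ]; exact preC_nonempty hp ih

def Kinf (p q : ℕ) (c : ℂ) : Set ℂ := ⋂ n, Cn p q c n

lemma Kinf_compact (hq : 1 ≤ q) (hpq : q < p) : IsCompact (Kinf p q c) :=
  (Cn_compact hq hpq 0).of_isClosed_subset
    (isClosed_iInter fun n => (Cn_compact hq hpq n).isClosed) (iInter_subset _ 0)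

lemma Kinf_nonempty (hq : 1 ≤ q) (hpq : q < p) : (Kinf p q c).Nonempty := by
  apply IsCompact.nonempty_iInter_of_sequence_nonempty_isCompact_isClosed
  · exact fun n => Cn_anti hq hpq (Nat.le_succ n)
  · exact fun n => (Un_nonempty (by omega) n).mono (Un_sub_Cn n)
  · exact Cn_compact hq hpq 0
  · exact fun n => (Cn_compact hq hpq n).isClosed

lemma Kinf_preC (hq : 1 ≤ q) (hpq : q < p) : Kinf p q c = preC p q c (Kinf p q c) := by
  apply Subset.antisymm
  · intro z hz
    have hcl : IsClosed {w : ℂ | (w - c) ^ q = z ^ p} := isClosed_eq (by fun_prop) (by fun_prop)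
    have : (⋂ n, (Cn p q c n ∩ {w : ℂ | (w - c) ^ q = z ^ p})).Nonempty := by
      apply IsCompact.nonempty_iInter_of_sequence_nonempty_isCompact_isClosed
      · exact fun n => inter_subset_inter_left _ (Cn_anti hq hpq (Nat.le_succ n))
      · intro n
        have h1 : z ∈ Cn p q c (n + 1) := mem_iInter.mp hz (n + 1)
        rw [Cn_succ] at h1
        obtain ⟨w, hw, e⟩ := h1
        exact ⟨w, hw, e⟩
      · exact (Cn_compact hq hpq 0).inter_right hcl
      · exact fun n => (Cn_compact hq hpq n).isClosed.inter hcl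
    obtain ⟨w, hw⟩ := this
    rw [mem_iInter] at hw
    exact ⟨w, mem_iInter.mpr fun n => (hw n).1, (hw 0).2⟩
  · rintro z ⟨w, hw, e⟩
    refine mem_iInter.mpr fun n => ?_
    apply Cn_anti hq hpq (Nat.le_succ n)
    rw [Nat.succ_eq_add_one, Cn_succ]
    exact ⟨w, mem_iInter.mp hw n, e⟩

lemma filledJulia_eq (hq : 1 ≤ q) (hpq : q < p) : filledJulia p q c = Kinf p q c := by
  apply Subset.antisymm
  · rintro z ⟨s, rfl, hs, hb⟩
    have hball : ∀ n, s n ∈ closedBall (0 : ℂ) (2 ^ q + ‖c‖ + 1) := by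
      intro n
      rw [mem_closedBall_zero_iff]
      by_contra! hn
      have hgrow : ∀ k : ℕ, 2 ^ q + ‖c‖ + 1 + k ≤ ‖s (n + k)‖ := by
        intro k
        induction k with
        | zero => simpa using hn.le
        | succ k ih =>
          have h0 : (0 : ℝ) ≤ k := Nat.cast_nonneg k
          have := escape (c := c) hq hpq (by linarith) (hs (n + k))
          push_cast
          rw [← add_assoc n k 1]
          linarith
      obtain ⟨M, hM⟩ := hb.exists_norm_le
      obtain ⟨k, hk⟩ := exists_nat_gt M
      have h1 := hM _ ⟨n + k, rfl⟩
      have h2 := hgrow k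
      have h3 : (0 : ℝ) ≤ 2 ^ q + ‖c‖ + 1 := by positivity
      linarith
    have : ∀ m n, s n ∈ Cn p q c m := by
      intro m
      induction m with
      | zero => exact hball
      | succ m ih => intro n; rw [Cn_succ]; exact ⟨s (n + 1), ih _, hs n⟩
    exact mem_iInter.mpr fun m => this m 0
  · intro z hz
    have hex : ∀ z ∈ Kinf p q c, ∃ w ∈ Kinf p q c, (w - c) ^ q = z ^ p := fun z hz => by
      rw [Kinf_preC hq hpq] at hz; exact hz
    choose! φ hφK hφ using hex
    have hmem : ∀ n, φ^[n] z ∈ Kinf p q c := by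
      intro n
      induction n with
      | zero => exact hz
      | succ n ih => rw [Function.iterate_succ_apply']; exact hφK _ ih
    refine ⟨fun n => φ^[n] z, rfl, ?_, ?_⟩
    · intro n
      show (φ^[n + 1] z - c) ^ q = _
      rw [Function.iterate_succ_apply']
      exact hφ _ (hmem n)
    · apply (Kinf_compact (c := c) hq hpq).isBounded.subset
      rintro _ ⟨n, rfl⟩
      exact hmem n

lemma Kinf_preconn (hq : 1 ≤ q) (hpq : q < p) (hall : ∀ n, IsPreconnected (Un p q c n)) :
    IsPreconnected (Kinf p q c) := by
  rw [isPreconnected_iff_subset_of_disjoint_closed]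
  intro u v hu hv hsub hdis
  have hKc := Kinf_compact (c := c) hq hpq
  have hd : Disjoint (Kinf p q c ∩ u) (Kinf p q c ∩ v) := by
    rw [Set.disjoint_iff]
    rintro x ⟨⟨h1, h2⟩, _, h3⟩
    rw [← hdis]; exact ⟨h1, h2, h3⟩
  obtain ⟨A, B, hA, hB, hKA, hKB, hAB⟩ :=
    SeparatedNhds.of_isCompact_isCompact (hKc.inter_right hu) (hKc.inter_right hv) hd
  have hKAB : Kinf p q c ⊆ A ∪ B := fun x hx => by
    rcases hsub hx with h | h
    · exact Or.inl (hKA ⟨hx, h⟩)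
    · exact Or.inr (hKB ⟨hx, h⟩)
  obtain ⟨n, hn⟩ := exists_subset_nhds_of_isCompact (V := Cn p q c)
    (Cn_anti hq hpq).directed_ge (fun n => Cn_compact hq hpq n)
    (U := A ∪ B) (fun x hx => (hA.union hB).mem_nhds (hKAB hx))
  have hUn : Un p q c n ⊆ A ∪ B := (Un_sub_Cn n).trans hn
  have hKU : Kinf p q c ⊆ Un p q c n := (iInter_subset _ (n + 1)).trans (Cn_sub_Un hq hpq n)
  rcases (isPreconnected_iff_subset_of_disjoint.mp (hall n)) A B hA hB hUn
    (by rw [hAB.inter_eq, inter_empty]) with h | h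
  · left
    intro x hx
    rcases hsub hx with h' | h'
    · exact h'
    · exact (Set.disjoint_left.mp hAB (h (hKU hx)) (hKB ⟨hx, h'⟩)).elim
  · right
    intro x hx
    rcases hsub hx with h' | h'
    · exact (Set.disjoint_left.mp hAB (hKA ⟨hx, h'⟩) (h (hKU hx))).elim
    · exact h'

lemma main_aux (hq : 1 ≤ q) (hpq : q < p) (hp : Nat.Prime p) :
    IsConnected (filledJulia p q c) ∨ IsCantorSet (filledJulia p q c) := by
  classical
  rw [filledJulia_eq hq hpq]
  have hKne := Kinf_nonempty (c := c) hq hpq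
  by_cases hall : ∀ n, IsPreconnected (Un p q c n)
  · exact Or.inl ⟨hKne, Kinf_preconn hq hpq hall⟩
  · right
    push Not at hall
    have hN := Nat.find_spec hall
    have hmin : ∀ m, m < Nat.find hall → IsPreconnected (Un p q c m) :=
      fun m hm => not_not.mp (Nat.find_min hall hm)
    generalize Nat.find hall = N at hN hmin
    have h0 : N ≠ 0 := by
      rintro rfl
      exact hN (convex_ball (0 : ℂ) _).isPreconnected
    obtain ⟨m, rfl⟩ := Nat.exists_eq_succ_of_ne_zero h0
    have hUm : IsConnected (Un p q c m) := ⟨Un_nonempty hp.pos m, hmin m (Nat.lt_succ_self m)⟩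
    rw [Nat.succ_eq_add_one, Un_succ] at hN
    obtain ⟨hc, hinj, G, hG, hGp⟩ := branch hp hq (Un_open hq m) hUm hN
    have hKc := Kinf_compact (c := c) hq hpq
    obtain ⟨h1, h2⟩ := cantor_case hp (R := 2 ^ q + ‖c‖ + 1) (C' := Cn p q c (m + 1))
      (K := Kinf p q c) (Un_open hq m) hUm
      (fun z hz => by
        have : z ∈ Cn p q c 0 := Cn_anti hq hpq (Nat.zero_le m) (Un_sub_Cn m hz)
        exact mem_closedBall_zero_iff.mp this)
      (Cn_compact hq hpq (m + 1)) (by rw [Cn_succ]; exact preC_mono (Un_sub_Cn m))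
      (Cn_sub_Un hq hpq m) hc hinj hG hGp hKc hKne
      ((iInter_subset _ (m + 1)).trans (Cn_sub_Un hq hpq m)) (Kinf_preC hq hpq)
    exact ⟨hKne, hKc, h1, h2⟩

end Dyn

end FJ

/-- For `p > q ≥ 1` with `p` prime, the filled Julia set `K_c` of
`f_c(z) = z^{p/q} + c` is either connected or a Cantor set. -/
theorem filledJulia_connected_or_cantor (p q : ℕ) (hq : 1 ≤ q) (hpq : q < p)
    (hp : Nat.Prime p) (c : ℂ) :
    IsConnected (filledJulia p q c) ∨ IsCantorSet (filledJulia p q c) := by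
  exact FJ.main_aux hq hpq hp
end

section
/- The Mandelbrot set M is compact and connected. -/
/-- The filled Julia set of the quadratic polynomial `f_c(z) = z² + c`: the set
of points with bounded forward orbit. -/
def quadFilledJulia (c : ℂ) : Set ℂ :=
  {z | Bornology.IsBounded (Set.range fun n : ℕ => (fun w : ℂ => w ^ 2 + c)^[n] z)}

/-- The Mandelbrot set: the connectedness locus of the quadratic family, i.e.
the set of `c` such that the filled Julia set of `z ↦ z² + c` is connected. -/
def mandelbrot : Set ℂ := {c | IsConnected (quadFilledJulia c)}

namespace MandelAux

open Set Filter Topology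

/-! ### General topology -/

/-- Preimages of connected sets under open and closed maps, when one fibre lies in a connected
subset of the preimage. -/
lemma isPreconnected_preimage {α β : Type*} [TopologicalSpace α] [TopologicalSpace β]
    {f : α → β} (ho : IsOpenMap f) (hcl : IsClosedMap f) {V : Set β} (hV : IsPreconnected V)
    {v₀ : β} (hv₀ : v₀ ∈ V) {S : Set α} (hS : IsPreconnected S) (hfib : f ⁻¹' {v₀} ⊆ S)
    (hSV : S ⊆ f ⁻¹' V) : IsPreconnected (f ⁻¹' V) := by
  intro u v hu hv huv hnu hnv
  by_contra hne
  have key : ∀ u v : Set α, IsOpen u → IsOpen v → f ⁻¹' V ⊆ u ∪ v → (f ⁻¹' V ∩ u).Nonempty →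
      ¬ (f ⁻¹' V ∩ (u ∩ v)).Nonempty → ∃ a, f a = v₀ ∧ a ∈ u := by
    intro u v hu hv huv hnu hne
    by_contra hno
    push Not at hno
    obtain ⟨x, hxV, hx1, hx2⟩ := hV (f '' u) (f '' vᶜ)ᶜ (ho u hu)
      (hcl _ hv.isClosed_compl).isOpen_compl (by
        intro x hx
        by_cases h : x ∈ f '' vᶜ
        · obtain ⟨a, ha, rfl⟩ := h
          exact Or.inl ⟨a, (huv hx).resolve_right ha, rfl⟩
        · exact Or.inr h)
      (by
        obtain ⟨a, ha, hau⟩ := hnu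
        exact ⟨f a, ha, a, hau, rfl⟩)
      ⟨v₀, hv₀, by
        rintro ⟨a, ha, hfa⟩
        exact hno a hfa ((huv (by simpa [hfa] using hv₀)).resolve_right ha)⟩
    obtain ⟨a, hau, rfl⟩ := hx1
    refine hne ⟨a, hxV, hau, ?_⟩
    by_contra hav
    exact hx2 ⟨a, hav, rfl⟩
  obtain ⟨a, ha, hau⟩ := key u v hu hv huv hnu hne
  obtain ⟨b, hb, hbv⟩ := key v u hv hu (by rwa [union_comm]) hnv (by rwa [inter_comm v u])
  obtain ⟨x, hxS, hx⟩ := hS u v hu hv (hSV.trans huv) ⟨a, hfib ha, hau⟩ ⟨b, hfib hb, hbv⟩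
  exact hne ⟨x, hSV hxS, hx⟩

/-- Decreasing intersections of compact connected sets are connected. -/
lemma isPreconnected_iInter {S : ℕ → Set ℂ} (hanti : Antitone S) (hc : ∀ n, IsCompact (S n))
    (hp : ∀ n, IsPreconnected (S n)) : IsPreconnected (⋂ n, S n) := by
  have hcomp : IsCompact (⋂ n, S n) :=
    (hc 0).of_isClosed_subset (isClosed_iInter fun n => (hc n).isClosed) (iInter_subset _ 0)
  rw [isPreconnected_iff_subset_of_fully_disjoint_closed hcomp.isClosed]
  intro u v hu hv huv hd
  obtain ⟨U, V, hU, hV, hsU, hsV, hUV⟩ := SeparatedNhds.of_isCompact_isCompact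
    (hcomp.inter_right hu) (hcomp.inter_right hv)
    (hd.mono inter_subset_right inter_subset_right)
  have hsub : (⋂ n, S n) ⊆ U ∪ V := fun x hx =>
    (huv hx).imp (fun h => hsU ⟨hx, h⟩) (fun h => hsV ⟨hx, h⟩)
  obtain ⟨n, hn⟩ := exists_subset_nhds_of_isCompact (V := S) hanti.directed_ge hc
    (U := U ∪ V) (fun x hx => (hU.union hV).mem_nhds (hsub hx))
  rcases (isPreconnected_iff_subset_of_disjoint.1 (hp n)) U V hU hV hn
    (by rw [hUV.inter_eq, inter_empty]) with h | h
  · left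
    intro x hx
    refine (huv hx).resolve_right fun hxv => ?_
    exact (disjoint_left.1 hUV) (h (mem_iInter.1 hx n)) (hsV ⟨hx, hxv⟩)
  · right
    intro x hx
    refine (huv hx).resolve_left fun hxu => ?_
    exact (disjoint_left.1 hUV) (hsU ⟨hx, hxu⟩) (h (mem_iInter.1 hx n))

lemma isPreconnected_ext {r : ℝ} (hr : 0 < r) : IsPreconnected {z : ℂ | r < ‖z‖} := by
  have h1 : IsPreconnected {z : ℂ | Real.log r < z.re} :=
    (convex_halfSpace_re_gt (Real.log r)).isPreconnected
  have h2 := h1.image Complex.exp Complex.continuous_exp.continuousOn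
  convert h2 using 1
  ext z
  constructor
  · intro hz
    have hz : r < ‖z‖ := hz
    have hz0 : z ≠ 0 := by
      rintro rfl
      simp at hz
      linarith
    refine ⟨Complex.log z, ?_, Complex.exp_log hz0⟩
    simp only [mem_ofPred_eq, Complex.log_re]
    exact Real.log_lt_log hr hz
  · rintro ⟨w, hw, rfl⟩
    simp only [mem_ofPred_eq, Complex.norm_exp] at hw ⊢
    exact (Real.log_lt_iff_lt_exp hr).1 hw

/-! ### Iteration -/

/-- Iterates of the quadratic polynomial. -/
def it (n : ℕ) (c z : ℂ) : ℂ := (fun w : ℂ => w ^ 2 + c)^[n] z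

@[simp] lemma it_zero (c z : ℂ) : it 0 c z = z := rfl

lemma it_succ (n : ℕ) (c z : ℂ) : it (n + 1) c z = it n c z ^ 2 + c := by
  simp only [it, Function.iterate_succ_apply']

lemma it_succ' (n : ℕ) (c z : ℂ) : it (n + 1) c z = it n c (z ^ 2 + c) := by
  simp only [it, Function.iterate_succ_apply]

lemma it_continuous (n : ℕ) : Continuous fun p : ℂ × ℂ => it n p.1 p.2 := by
  induction n with
  | zero => simpa using continuous_snd
  | succ n ih => simp only [it_succ]; fun_prop

lemma it_continuous_z (n : ℕ) (c : ℂ) : Continuous fun z : ℂ => it n c z :=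
  (it_continuous n).comp (by fun_prop : Continuous fun z : ℂ => (c, z))

lemma escape {c z : ℂ} (h3 : 3 < ‖z‖) (hc : ‖c‖ ≤ ‖z‖) : 2 * ‖z‖ < ‖z ^ 2 + c‖ := by
  have h1 : ‖z ^ 2‖ ≤ ‖z ^ 2 + c‖ + ‖c‖ := by
    have := norm_sub_le (z ^ 2 + c) c
    simpa using this
  rw [norm_pow] at h1
  nlinarith

lemma escape_it {c z : ℂ} (h3 : 3 < ‖z‖) (hc : ‖c‖ ≤ ‖z‖) (n : ℕ) :
    2 ^ n * ‖z‖ ≤ ‖it n c z‖ := by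
  induction n with
  | zero => simp
  | succ n ih =>
    have h1 : ‖z‖ ≤ ‖it n c z‖ := by
      refine le_trans ?_ ih
      have : (1 : ℝ) ≤ 2 ^ n := one_le_pow₀ (by norm_num)
      nlinarith [norm_nonneg z]
    have := escape (c := c) (lt_of_lt_of_le h3 h1) (hc.trans h1)
    rw [it_succ, pow_succ]
    linarith

lemma it_add (m n : ℕ) (c z : ℂ) : it (m + n) c z = it m c (it n c z) := by
  simp only [it, Function.iterate_add_apply]

/-- The norm stays above once escaped. -/
lemma escape_mono {c z : ℂ} {i n : ℕ} (hin : i ≤ n) (h3 : 3 < ‖it i c z‖)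
    (hc : ‖c‖ ≤ ‖it i c z‖) : ‖it i c z‖ ≤ ‖it n c z‖ := by
  obtain ⟨m, rfl⟩ := Nat.exists_eq_add_of_le' hin
  rw [it_add]
  refine le_trans ?_ (escape_it h3 hc m)
  have : (1 : ℝ) ≤ 2 ^ m := one_le_pow₀ (by norm_num)
  nlinarith [norm_nonneg (it i c z)]

lemma mem_K_iff {c z : ℂ} {R : ℝ} (hR : 3 ≤ R) (hc : ‖c‖ ≤ R) :
    z ∈ quadFilledJulia c ↔ ∀ n, ‖it n c z‖ ≤ R := by
  change Bornology.IsBounded (range fun n => it n c z) ↔ _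
  rw [isBounded_iff_forall_norm_le]
  constructor
  · rintro ⟨B, hB⟩ n
    by_contra hn
    push Not at hn
    have h1 : ∀ m, 2 ^ m * ‖it n c z‖ ≤ B := fun m =>
      (escape_it (c := c) (by linarith) (by linarith) m).trans (by
        rw [← it_add]; exact hB _ ⟨_, rfl⟩)
    obtain ⟨m, hm⟩ := pow_unbounded_of_one_lt B (one_lt_two)
    have := h1 m
    have h2 : (0 : ℝ) < 2 ^ m := by positivity
    nlinarith
  · intro h
    exact ⟨R, by rintro _ ⟨n, rfl⟩; exact h n⟩

/-- The critical orbit. -/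
def Q (n : ℕ) (c : ℂ) : ℂ := it n c 0

lemma Q_succ (n : ℕ) (c : ℂ) : Q (n + 1) c = Q n c ^ 2 + c := it_succ n c 0

lemma Q_succ' (n : ℕ) (c : ℂ) : Q (n + 1) c = it n c c := by
  simp [Q, it_succ']

lemma Q_continuous (n : ℕ) : Continuous (Q n) :=
  (it_continuous n).comp (by fun_prop : Continuous fun c : ℂ => (c, (0 : ℂ)))

lemma Q_big {c : ℂ} (hc : 3 < ‖c‖) (n : ℕ) : ‖c‖ ≤ ‖Q (n + 1) c‖ := by
  rw [Q_succ']
  have := escape_mono (c := c) (z := c) (Nat.zero_le n) (by simpa) (by simp)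
  simpa using this

lemma norm_c_le {c : ℂ} {n : ℕ} {R : ℝ} (hR : 3 ≤ R) (h : ‖Q (n + 1) c‖ ≤ R) : ‖c‖ ≤ R := by
  by_contra hc
  push Not at hc
  have := Q_big (c := c) (by linarith) n
  linarith

lemma norm_c_le' {c : ℂ} {n : ℕ} (h : 3 < ‖Q n c‖) : ‖c‖ ≤ ‖Q n c‖ := by
  cases n with
  | zero => simp [Q] at h; linarith
  | succ n => exact norm_c_le h.le le_rfl

lemma Q_le_of_le {c : ℂ} {i n : ℕ} (hin : i ≤ n) (h : 3 < ‖Q n c‖) : ‖Q i c‖ ≤ ‖Q n c‖ := by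
  by_contra hlt
  push Not at hlt
  have := escape_mono (c := c) (z := 0) hin (h.trans hlt) ((norm_c_le' h).trans hlt.le)
  exact absurd hlt (not_lt.2 this)

lemma Q_lt_succ {c : ℂ} {n : ℕ} (h : 3 < ‖Q n c‖) : ‖Q n c‖ < ‖Q (n + 1) c‖ := by
  have := escape (c := c) h (norm_c_le' h)
  rw [Q_succ]
  linarith

/-! ### Connectedness of the filled Julia set -/

lemma f_isOpenMap (c : ℂ) : IsOpenMap fun z : ℂ => z ^ 2 + c := by
  have := (Complex.isOpenQuotientMap_pow 2).isOpenMap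
  exact (Homeomorph.addRight c).isOpenMap.comp this

lemma f_isClosedMap (c : ℂ) : IsClosedMap fun z : ℂ => z ^ 2 + c :=
  (Homeomorph.addRight c).isClosedMap.comp (isClosedMap_pow ℂ 2)

lemma K_connected {c : ℂ} (h0 : (0 : ℂ) ∈ quadFilledJulia c) :
    IsConnected (quadFilledJulia c) := by
  refine ⟨⟨0, h0⟩, ?_⟩
  set R : ℝ := max 3 ‖c‖ with hRdef
  have hR : 3 ≤ R := le_max_left _ _
  have hc : ‖c‖ ≤ R := le_max_right _ _
  rw [mem_K_iff hR hc] at h0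
  have hK : quadFilledJulia c = ⋂ n, {z | ‖it n c z‖ ≤ R} := by
    ext z
    rw [mem_K_iff hR hc, mem_iInter]
    rfl
  have hanti : Antitone fun n => {z : ℂ | ‖it n c z‖ ≤ R} := by
    refine antitone_nat_of_succ_le fun n z hz => ?_
    by_contra hlt
    have hlt : R < ‖it n c z‖ := not_le.1 hlt
    have hz : ‖it (n + 1) c z‖ ≤ R := hz
    have := escape_mono (c := c) (z := z) (Nat.le_succ n) (by linarith) (by linarith)
    simp only [Nat.succ_eq_add_one] at this
    linarith
  rw [hK]
  refine isPreconnected_iInter hanti (fun n => ?_) (fun n => ?_)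
  · refine (isCompact_closedBall (0 : ℂ) R).of_isClosed_subset
      (isClosed_le (it_continuous_z n c).norm continuous_const) ?_
    intro z hz
    simpa using hanti (Nat.zero_le n) hz
  · induction n with
    | zero => simpa [Metric.closedBall] using (Metric.isPreconnected_closedBall (x := (0 : ℂ)) (r := R))
    | succ n ih =>
      have := isPreconnected_preimage (f_isOpenMap c) (f_isClosedMap c) ih (v₀ := c) (by
        have := h0 (n + 1)
        rw [it_succ'] at this
        simpa using this) (S := {0}) isPreconnected_singleton (by intro z hz; simpa using hz) (by
        rintro z rfl
        have := h0 (n + 1)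
        rw [it_succ'] at this
        simpa using this)
      simpa only [preimage_ofPred_eq, ← it_succ'] using this

lemma Kcompl_preconnected (c : ℂ) : IsPreconnected (quadFilledJulia c)ᶜ := by
  set R : ℝ := max 3 ‖c‖ with hRdef
  have hR : 3 ≤ R := le_max_left _ _
  have hc : ‖c‖ ≤ R := le_max_right _ _
  have hK : (quadFilledJulia c)ᶜ = ⋃ n, {z | R < ‖it n c z‖} := by
    ext z
    rw [mem_compl_iff, mem_K_iff hR hc, mem_iUnion]
    push Not
    rfl
  have hmono : ∀ n, {z : ℂ | R < ‖z‖} ⊆ {z | R < ‖it n c z‖} := by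
    intro n z hz
    have hz : R < ‖z‖ := hz
    have := escape_mono (c := c) (z := z) (Nat.zero_le n) (by simp; linarith) (by simp; linarith)
    simp only [it_zero] at this
    exact lt_of_lt_of_le hz this
  rw [hK]
  have hbig : ((R + R ^ 2 + R + 1 : ℝ) : ℂ) ∈ {z : ℂ | R < ‖z‖} := by
    change R < ‖((R + R ^ 2 + R + 1 : ℝ) : ℂ)‖
    rw [Complex.norm_real, Real.norm_eq_abs]
    refine lt_of_lt_of_le ?_ (le_abs_self _)
    nlinarith
  refine isPreconnected_iUnion ⟨_, mem_iInter.2 fun n => hmono n hbig⟩ fun n => ?_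
  induction n with
  | zero => simpa using isPreconnected_ext (r := R) (by linarith)
  | succ n ih =>
    have := isPreconnected_preimage (f_isOpenMap c) (f_isClosedMap c) ih
      (hmono n hbig) (S := {z : ℂ | R < ‖z‖})
      (isPreconnected_ext (r := R) (by linarith)) (by
        intro z hz
        by_contra hlt
        have hlt : ‖z‖ ≤ R := not_lt.1 hlt
        have hz : z ^ 2 + c = ((R + R ^ 2 + R + 1 : ℝ) : ℂ) := hz
        have h1 : ‖z ^ 2 + c‖ = R + R ^ 2 + R + 1 := by
          rw [hz, Complex.norm_real, Real.norm_eq_abs, abs_of_nonneg (by positivity)]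
        have h2 := norm_add_le (z ^ 2) c
        rw [norm_pow] at h2
        nlinarith [norm_nonneg z])
      (by
        have := hmono (n + 1)
        simpa only [preimage_ofPred_eq, ← it_succ'] using this)
    simpa only [preimage_ofPred_eq, ← it_succ'] using this

lemma sqrt_sub {K : Set ℂ} (hK : IsCompact K) (hKc : IsPreconnected Kᶜ) {p : ℂ} (hp : p ∉ K) :
    ∃ s : ℂ → ℂ, ContinuousOn s K ∧ ∀ z ∈ K, s z ^ 2 = z - p := by
  -- local square root of quotients
  have hloc : ∀ p q : ℂ, p ∉ K → (∀ z ∈ K, ‖p - q‖ < ‖z - p‖) →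
      ∃ s : ℂ → ℂ, ContinuousOn s K ∧ ∀ z ∈ K, s z ^ 2 * (z - p) = z - q := by
    intro p q hp hpq
    have hne : ∀ z ∈ K, z - p ≠ 0 := fun z hz h => hp (by rw [← sub_eq_zero.1 h]; exact hz)
    have hsl : ∀ z ∈ K, (z - q) / (z - p) ∈ Complex.slitPlane := by
      intro z hz
      left
      have h1 : (z - q) / (z - p) = 1 + (p - q) / (z - p) := by
        field_simp [hne z hz]
        ring
      have h2 : ‖(p - q) / (z - p)‖ < 1 := by
        rw [norm_div, div_lt_one (norm_pos_iff.2 (hne z hz))]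
        exact hpq z hz
      have h3 := Complex.abs_re_le_norm ((p - q) / (z - p))
      have h4 := neg_abs_le ((p - q) / (z - p)).re
      rw [h1, Complex.add_re, Complex.one_re]
      linarith
    refine ⟨fun z => Complex.exp (Complex.log ((z - q) / (z - p)) / 2), ?_, ?_⟩
    · refine Complex.continuous_exp.comp_continuousOn (ContinuousOn.div_const ?_ _)
      refine ContinuousOn.clog ?_ hsl
      exact ContinuousOn.div (by fun_prop) (by fun_prop) hne
    · intro z hz
      have h5 : (z - q) / (z - p) ≠ 0 := Complex.slitPlane_ne_zero (hsl z hz)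
      rw [← Complex.exp_nat_mul]
      rw [show ((2 : ℕ) : ℂ) * (Complex.log ((z - q) / (z - p)) / 2)
        = Complex.log ((z - q) / (z - p)) by push_cast; ring, Complex.exp_log h5,
        div_mul_cancel₀ _ (hne z hz)]
  set T : Set ℂ := {p | p ∉ K ∧ ∃ s : ℂ → ℂ, ContinuousOn s K ∧ ∀ z ∈ K, s z ^ 2 = z - p} with hT
  have htrans : ∀ p q : ℂ, p ∈ T → q ∉ K → (∀ z ∈ K, ‖p - q‖ < ‖z - p‖) → q ∈ T := by
    rintro p q ⟨hp, s, hs, hs2⟩ hq hpq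
    obtain ⟨t, ht, ht2⟩ := hloc p q hp hpq
    refine ⟨hq, fun z => t z * s z, ht.mul hs, fun z hz => ?_⟩
    rw [mul_pow, hs2 z hz, ht2 z hz]
  have hball : ∀ p ∉ K, ∃ ε > 0, ∀ z ∈ K, ε ≤ ‖z - p‖ := by
    intro p hp
    obtain ⟨ε, hε, h⟩ := Metric.isOpen_iff.1 hK.isClosed.isOpen_compl p hp
    refine ⟨ε, hε, fun z hz => ?_⟩
    by_contra hlt
    exact h (show z ∈ Metric.ball p ε by rw [Metric.mem_ball, dist_eq_norm]; exact not_le.1 hlt) hz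
  have hTopen : IsOpen T := by
    rw [Metric.isOpen_iff]
    intro p hp
    obtain ⟨ε, hε, h⟩ := hball p hp.1
    refine ⟨ε, hε, fun q hq => ?_⟩
    rw [Metric.mem_ball, dist_eq_norm] at hq
    refine htrans p q hp (fun hqK => ?_) (fun z hz => ?_)
    · have := h q hqK
      linarith
    · rw [norm_sub_rev]
      exact hq.trans_le (h z hz)
  have hsub : Kᶜ ⊆ T := by
    refine hKc.subset_of_closure_inter_subset hTopen ?_ ?_
    · -- a far away point
      obtain ⟨B, hB⟩ := hK.isBounded.exists_norm_le
      set q : ℂ := ((|B| + 1 : ℝ) : ℂ) with hq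
      have hqn : ‖q‖ = |B| + 1 := by
        rw [hq, Complex.norm_real, Real.norm_eq_abs, abs_of_nonneg (by positivity)]
      have hqK : q ∉ K := fun h => by
        have := hB q h
        have := le_abs_self B
        linarith
      have hq0 : q ≠ 0 := by
        rw [← norm_pos_iff, hqn]
        positivity
      have hsl : ∀ z ∈ K, 1 - z / q ∈ Complex.slitPlane := by
        intro z hz
        left
        have h2 : ‖z / q‖ < 1 := by
          rw [norm_div, div_lt_one (norm_pos_iff.2 hq0), hqn]
          have := hB z hz
          have := le_abs_self B
          linarith
        have h3 := Complex.re_le_norm (z / q)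
        rw [Complex.sub_re, Complex.one_re]
        linarith
      refine ⟨q, hqK, hqK, fun z => Complex.exp (Complex.log (1 - z / q) / 2) *
        Complex.exp (Complex.log (-q) / 2), ?_, ?_⟩
      · refine ContinuousOn.mul ?_ continuousOn_const
        refine Complex.continuous_exp.comp_continuousOn (ContinuousOn.div_const ?_ _)
        exact ContinuousOn.clog (by fun_prop) hsl
      · intro z hz
        have h5 : 1 - z / q ≠ 0 := Complex.slitPlane_ne_zero (hsl z hz)
        have hhalf : ∀ w : ℂ, w ≠ 0 → Complex.exp (Complex.log w / 2) ^ 2 = w := by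
          intro w hw
          rw [← Complex.exp_nat_mul, show ((2 : ℕ) : ℂ) * (Complex.log w / 2) = Complex.log w by
            push_cast; ring, Complex.exp_log hw]
        rw [mul_pow, hhalf _ h5, hhalf _ (neg_ne_zero.2 hq0)]
        field_simp
        ring
    · rintro q ⟨hqc, hqK⟩
      obtain ⟨ε, hε, h⟩ := hball q hqK
      obtain ⟨p, hpT, hpq⟩ := Metric.mem_closure_iff.1 hqc (ε / 2) (by linarith)
      rw [dist_comm, dist_eq_norm] at hpq
      refine htrans p q hpT hqK fun z hz => ?_
      have h1 := h z hz
      have h2 := norm_sub_le_norm_sub_add_norm_sub z p q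
      linarith
  exact (hsub hp).2

lemma K_compact (c : ℂ) : IsCompact (quadFilledJulia c) := by
  set R : ℝ := max 3 ‖c‖ with hRdef
  have hR : 3 ≤ R := le_max_left _ _
  have hc : ‖c‖ ≤ R := le_max_right _ _
  have hK : quadFilledJulia c = ⋂ n, {z | ‖it n c z‖ ≤ R} := by
    ext z
    rw [mem_K_iff hR hc, mem_iInter]
    rfl
  rw [hK]
  refine (isCompact_closedBall (0 : ℂ) R).of_isClosed_subset
      (isClosed_iInter fun n => isClosed_le (it_continuous_z n c).norm continuous_const) ?_
  intro z hz
  simpa using mem_iInter.1 hz 0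

lemma K_step (c z : ℂ) : z ^ 2 + c ∈ quadFilledJulia c ↔ z ∈ quadFilledJulia c := by
  rw [mem_K_iff (le_max_left 3 ‖c‖) (le_max_right 3 ‖c‖),
    mem_K_iff (le_max_left 3 ‖c‖) (le_max_right 3 ‖c‖)]
  simp only [← it_succ']
  refine ⟨fun h n => ?_, fun h n => h _⟩
  by_contra hlt
  push Not at hlt
  have := escape_mono (c := c) (z := z) (Nat.le_succ n) (lt_of_le_of_lt (le_max_left _ _) hlt)
    ((le_max_right 3 ‖c‖).trans hlt.le)
  exact absurd (hlt.trans_le this) (not_lt.2 (h n))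

lemma zero_mem_of_connected {c : ℂ} (h : IsConnected (quadFilledJulia c)) :
    (0 : ℂ) ∈ quadFilledJulia c := by
  by_contra h0
  have hcK : c ∉ quadFilledJulia c := fun hc => h0 ((K_step c 0).1 (by simpa using hc))
  obtain ⟨s, hs, hs2⟩ := sqrt_sub (K_compact c) (Kcompl_preconnected c) hcK
  obtain ⟨z₀, hz₀⟩ := h.nonempty
  set A := s '' quadFilledJulia c with hA
  set B := (fun z => - s z) '' quadFilledJulia c with hB
  have hAc : IsClosed A := ((K_compact c).image_of_continuousOn hs).isClosed
  have hBc : IsClosed B := ((K_compact c).image_of_continuousOn hs.neg).isClosed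
  have hsK : ∀ z ∈ quadFilledJulia c, s z ∈ quadFilledJulia c := fun z hz => by
    rw [← K_step, hs2 z hz]; simpa using hz
  have hsK' : ∀ z ∈ quadFilledJulia c, - s z ∈ quadFilledJulia c := fun z hz => by
    rw [← K_step, neg_sq, hs2 z hz]; simpa using hz
  obtain ⟨w, hw, ⟨z, hz, hzw⟩, ⟨z', hz', hzw'⟩⟩ := isPreconnected_closed_iff.1 h.isPreconnected A B hAc hBc (by
      intro w hw
      have h1 := hs2 _ ((K_step c w).2 hw)
      have h2 : s (w ^ 2 + c) ^ 2 = w ^ 2 := by rw [h1]; ring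
      rcases sq_eq_sq_iff_eq_or_eq_neg.1 h2 with h3 | h3
      · exact Or.inl ⟨_, (K_step c w).2 hw, h3⟩
      · exact Or.inr ⟨_, (K_step c w).2 hw, by simp [h3]⟩)
    ⟨s z₀, hsK z₀ hz₀, z₀, hz₀, rfl⟩ ⟨- s z₀, hsK' z₀ hz₀, z₀, hz₀, rfl⟩
  simp only at hzw'
  have e1 := hs2 z hz
  have e2 := hs2 z' hz'
  have e3 : z = z' := by
    have : s z ^ 2 = s z' ^ 2 := by rw [hzw, ← hzw']; ring
    rw [e1, e2] at this
    linear_combination this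
  subst e3
  have e4 : s z = 0 := by
    have : s z + s z = 0 := by linear_combination hzw - hzw'
    simpa using this
  rw [e4] at e1
  have e5 : c = z := by linear_combination e1
  exact hcK (e5 ▸ hz)

lemma mandelbrot_eq : mandelbrot = {c | (0 : ℂ) ∈ quadFilledJulia c} := by
  ext c
  exact ⟨zero_mem_of_connected, K_connected⟩

lemma mandelbrot_eq_iInter : mandelbrot = ⋂ n, {c | ‖Q (n + 1) c‖ ≤ 13} := by
  rw [mandelbrot_eq]
  ext c
  rw [mem_iInter]
  constructor
  · intro h n
    have h : (0 : ℂ) ∈ quadFilledJulia c := h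
    have h3 := (mem_K_iff (le_max_left 3 ‖c‖) (le_max_right 3 ‖c‖)).1 h
    have hc : ‖c‖ ≤ 13 := by
      by_contra hc
      push Not at hc
      have h1 := h3 2
      have h2 := escape (c := c) (z := c) (by linarith) le_rfl
      simp only [it_succ, it_zero] at h1
      rw [max_eq_right (by linarith)] at h1
      simp at h1
      linarith
    exact (mem_K_iff (R := 13) (by norm_num) hc).1 h (n + 1)
  · intro h
    change (0 : ℂ) ∈ quadFilledJulia c
    rw [mem_K_iff (R := 13) (by norm_num) (norm_c_le (by norm_num) (h 0))]
    intro n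
    cases n with
    | zero => simp
    | succ n => exact h n

/-! ### Connectedness of sublevel sets -/

lemma sublevel_preconnected (q : Polynomial ℂ) {d : ℕ} (hd : d ≠ 0) (hq : q.natDegree = d)
    {r t : ℝ} (hr : 0 < r) (hrt : r < t) (Φ : {c : ℂ // r < ‖q.eval c‖} → ℂ) (hΦ : Continuous Φ)
    (hΦd : ∀ c, Φ c ^ d = q.eval c.1) : IsPreconnected {c : ℂ | ‖q.eval c‖ ≤ t} := by
  have hdeg : 0 < q.degree := Polynomial.natDegree_pos_iff_degree_pos.1 (by omega)
  have hprop : IsProperMap q.eval := q.isProperMap_eval hdeg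
  have hqo : IsOpenQuotientMap q.eval := q.isOpenQuotientMap_eval (by omega)
  have hXo : IsOpen {c : ℂ | r < ‖q.eval c‖} := isOpen_lt continuous_const q.continuous.norm
  have hΦ0 : ∀ c, Φ c ≠ 0 := by
    intro c h
    have h1 := hΦd c
    have h2 := c.2
    rw [h, zero_pow hd] at h1
    rw [← h1] at h2
    simp at h2
    linarith
  have hdC : (d : ℂ) ≠ 0 := by exact_mod_cast hd
  -- openness
  have hopen : IsOpenMap Φ := by
    rw [isOpenMap_iff_nhds_le]
    intro c
    -- local injectivity of the power map
    have hinj : ∃ U ∈ 𝓝 (Φ c), InjOn (fun w : ℂ => w ^ d) U := by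
      have hs : HasStrictDerivAt (fun w : ℂ => w ^ d) ((d : ℂ) * Φ c ^ (d - 1)) (Φ c) :=
        hasStrictDerivAt_pow d (Φ c)
      have hne : (d : ℂ) * Φ c ^ (d - 1) ≠ 0 := mul_ne_zero hdC (pow_ne_zero _ (hΦ0 c))
      have he := hs.hasStrictFDerivAt_equiv hne
      refine ⟨he.toOpenPartialHomeomorph.source, ?_, ?_⟩
      · exact he.toOpenPartialHomeomorph.open_source.mem_nhds he.mem_toOpenPartialHomeomorph_source
      · exact he.toOpenPartialHomeomorph.injOn
    obtain ⟨U, hU, hUinj⟩ := hinj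
    intro S hS
    rw [mem_map] at hS
    have hS2 : Φ ⁻¹' S ∩ Φ ⁻¹' U ∈ 𝓝 c := inter_mem hS (hΦ.continuousAt hU)
    have h1 : Subtype.val '' (Φ ⁻¹' S ∩ Φ ⁻¹' U) ∈ 𝓝 c.1 :=
      hXo.isOpenEmbedding_subtypeVal.isOpenMap.image_mem_nhds hS2
    have h2 := hqo.isOpenMap.image_mem_nhds h1
    rw [← hΦd] at h2
    have h3 : (fun w : ℂ => w ^ d) ⁻¹' (q.eval '' (Subtype.val '' (Φ ⁻¹' S ∩ Φ ⁻¹' U))) ∈ 𝓝 (Φ c) :=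
      (continuous_pow d).continuousAt h2
    filter_upwards [h3, hU] with w hw hwU
    obtain ⟨_, ⟨c', ⟨hcS2, hc'U⟩, rfl⟩, hc'⟩ := hw
    have : Φ c' = w := hUinj hc'U hwU (by rw [← hc']; exact hΦd c')
    rw [← this]
    exact hcS2
  -- surjectivity
  set ρ : ℝ := r ^ ((d : ℝ)⁻¹) with hρ
  have hρ0 : 0 < ρ := Real.rpow_pos_of_pos hr _
  have hρd : ρ ^ d = r := Real.rpow_inv_natCast_pow hr.le hd
  have hmem : ∀ w : ℂ, ρ < ‖w‖ ↔ r < ‖w ^ d‖ := by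
    intro w
    rw [norm_pow, ← hρd]
    exact (pow_lt_pow_iff_left₀ hρ0.le (norm_nonneg _) hd).symm
  have hsurj : {w : ℂ | ρ < ‖w‖} ⊆ range Φ := by
    refine (isPreconnected_ext hρ0).subset_of_closure_inter_subset hopen.isOpen_range ?_ ?_
    · obtain ⟨c, hc⟩ := hqo.surjective (((r + 1 : ℝ)) : ℂ)
      have hc : q.eval c = (((r + 1 : ℝ)) : ℂ) := hc
      have hc' : r < ‖q.eval c‖ := by
        rw [hc, Complex.norm_real, Real.norm_eq_abs, abs_of_nonneg (by linarith)]
        linarith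
      refine ⟨Φ ⟨c, hc'⟩, ?_, mem_range_self _⟩
      change ρ < _
      rw [hmem, hΦd]
      exact hc'
    · rintro w ⟨hwc, hw⟩
      have hw : ρ < ‖w‖ := hw
      rw [hmem] at hw
      obtain ⟨x, hx, hxw⟩ := mem_closure_iff_seq_limit.1 hwc
      choose y hy using hx
      -- bounded
      have hq1 : Tendsto (fun i => q.eval (y i).1) atTop (𝓝 (w ^ d)) := by
        have := hxw.pow d
        refine this.congr fun i => ?_
        rw [← hy, hΦd]
      have hcpt : IsCompact (q.eval ⁻¹' (Metric.closedBall (w ^ d) 1)) :=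
        hprop.isCompact_preimage (isCompact_closedBall _ _)
      have hev : ∀ᶠ i in atTop, (y i).1 ∈ q.eval ⁻¹' (Metric.closedBall (w ^ d) 1) :=
        hq1 (Metric.closedBall_mem_nhds _ one_pos)
      obtain ⟨c, -, φ, hφ, hlim⟩ := hcpt.tendsto_subseq' hev.frequently
      have hqc : q.eval c = w ^ d :=
        tendsto_nhds_unique ((q.continuous.tendsto c).comp hlim) (hq1.comp hφ.tendsto_atTop)
      have hcX : r < ‖q.eval c‖ := by rwa [hqc]
      refine ⟨⟨c, hcX⟩, ?_⟩
      have hl2 : Tendsto (fun i => y (φ i)) atTop (𝓝 (⟨c, hcX⟩ : {c : ℂ // r < ‖q.eval c‖})) := by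
        rw [tendsto_subtype_rng]
        exact hlim
      refine tendsto_nhds_unique ((hΦ.tendsto _).comp hl2) ?_
      refine (hxw.comp hφ.tendsto_atTop).congr fun i => ?_
      simp [hy]
  -- injectivity
  have hinj : Function.Injective Φ := by
    intro a b hab
    set w := Φ a with hw
    have hw0 : w ≠ 0 := hΦ0 a
    have hdp : 0 < d := Nat.pos_of_ne_zero hd
    have hqne : q - Polynomial.C (w ^ d) ≠ 0 := by
      intro h
      have := sub_eq_zero.1 h
      rw [this, Polynomial.natDegree_C] at hq
      exact hd hq.symm
    have hnd : (q - Polynomial.C (w ^ d)).natDegree = d := by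
      rw [Polynomial.natDegree_sub_C, hq]
    classical
    set F : Finset ℂ := (q - Polynomial.C (w ^ d)).roots.toFinset with hF
    have hFcard : F.card ≤ d := by
      refine (Multiset.toFinset_card_le _).trans ?_
      exact (Polynomial.card_roots' _).trans hnd.le
    have hFmem : ∀ c, c ∈ F ↔ q.eval c = w ^ d := by
      intro c
      rw [hF, Multiset.mem_toFinset, Polynomial.mem_roots hqne]
      simp [Polynomial.IsRoot, sub_eq_zero]
    have hζ := Complex.isPrimitiveRoot_exp d hd
    set G : Finset ℂ := (Polynomial.nthRoots d (w ^ d)).toFinset with hG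
    have hGcard : G.card = d := by
      rw [hG, Multiset.toFinset_card_of_nodup (hζ.nthRoots_nodup (pow_ne_zero _ hw0)),
        hζ.card_nthRoots, if_pos ⟨w, rfl⟩]
    have hGmem : ∀ c, c ∈ G ↔ c ^ d = w ^ d := by
      intro c
      rw [hG, Multiset.mem_toFinset, Polynomial.mem_nthRoots hdp]
    have hwr : r < ‖w ^ d‖ := by
      rw [hw, hΦd]; exact a.2
    set Ψ : ℂ → ℂ := fun c => if h : r < ‖q.eval c‖ then Φ ⟨c, h⟩ else 0 with hΨ
    have hΨa : ∀ c : {c : ℂ // r < ‖q.eval c‖}, Ψ c.1 = Φ c := by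
      intro c
      simp only [hΨ]
      rw [dif_pos c.2]
    have hres := Finset.injOn_of_surjOn_of_card_le (s := F) (t := G) Ψ (by
        intro c hc
        have hc : q.eval c = w ^ d := (hFmem c).1 hc
        have hcX : r < ‖q.eval c‖ := by rwa [hc]
        refine (hGmem _).2 ?_
        rw [hΨa ⟨c, hcX⟩, hΦd, hc]) (by
        intro v hv
        have hv : v ^ d = w ^ d := (hGmem v).1 hv
        obtain ⟨c, hc⟩ := hsurj (show ρ < ‖v‖ by rw [hmem, hv]; exact hwr)
        refine ⟨c.1, (hFmem _).2 ?_, ?_⟩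
        · rw [← hΦd, hc, hv]
        · rw [hΨa, hc]) (by rw [hGcard]; exact hFcard)
    refine Subtype.ext (hres ((hFmem _).2 ?_) ((hFmem _).2 ?_) ?_)
    · rw [← hΦd]
    · rw [← hΦd, hab]
    · rw [hΨa, hΨa]; exact hab
  -- the level set is connected
  have ht0 : 0 < t := hr.trans hrt
  have hL : IsPreconnected {c : ℂ | ‖q.eval c‖ = t} := by
    have h1 : IsPreconnected (Metric.sphere (0 : ℂ) (t ^ ((d : ℝ)⁻¹))) :=
      isPreconnected_sphere (by simp) _ _
    have htd : (t ^ ((d : ℝ)⁻¹)) ^ d = t := Real.rpow_inv_natCast_pow ht0.le hd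
    have htp : 0 < t ^ ((d : ℝ)⁻¹) := Real.rpow_pos_of_pos ht0 _
    have h2 := h1.preimage_of_isOpenMap hinj hopen (by
      intro w hw
      refine hsurj ?_
      change ρ < ‖w‖
      rw [hmem, norm_pow, mem_sphere_zero_iff_norm.1 hw, htd]
      exact hrt)
    have h3 := h2.image Subtype.val continuous_subtype_val.continuousOn
    convert h3 using 1
    ext c
    constructor
    · intro hc
      have hc : ‖q.eval c‖ = t := hc
      refine ⟨⟨c, by rw [hc]; exact hrt⟩, ?_, rfl⟩
      rw [mem_preimage, mem_sphere_zero_iff_norm]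
      rw [← pow_left_inj₀ (norm_nonneg _) htp.le hd, htd, ← norm_pow, hΦd]
      exact hc
    · rintro ⟨c, hc, rfl⟩
      rw [mem_preimage, mem_sphere_zero_iff_norm] at hc
      change ‖q.eval c.1‖ = t
      rw [← hΦd, norm_pow, hc, htd]
  -- conclusion
  have hNcl : IsClosed {c : ℂ | ‖q.eval c‖ ≤ t} := isClosed_le q.continuous.norm continuous_const
  have hNcpt : IsCompact {c : ℂ | ‖q.eval c‖ ≤ t} := by
    have := hprop.isCompact_preimage (isCompact_closedBall (0 : ℂ) t)
    convert this using 1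
    ext c
    simp
  rw [isPreconnected_iff_subset_of_fully_disjoint_closed hNcl]
  have key : ∀ u v : Set ℂ, IsClosed u → IsClosed v → {c : ℂ | ‖q.eval c‖ ≤ t} ⊆ u ∪ v →
      Disjoint u v → {c : ℂ | ‖q.eval c‖ = t} ⊆ u → {c : ℂ | ‖q.eval c‖ ≤ t} ⊆ u := by
    intro u v hu hv huv hd' hLu
    set B := {c : ℂ | ‖q.eval c‖ ≤ t} ∩ v with hB
    have hBcl : IsClosed B := hNcl.inter hv
    have hBop : IsOpen B := by
      have : B = {c : ℂ | ‖q.eval c‖ < t} ∩ uᶜ := by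
        ext c
        constructor
        · rintro ⟨hc, hcv⟩
          have hc : ‖q.eval c‖ ≤ t := hc
          have hcu : c ∉ u := fun h => disjoint_left.1 hd' h hcv
          exact ⟨lt_of_le_of_ne hc fun h => hcu (hLu h), hcu⟩
        · rintro ⟨hc, hcu⟩
          have hc : ‖q.eval c‖ < t := hc
          exact ⟨hc.le, (huv hc.le).resolve_left hcu⟩
      rw [this]
      exact (isOpen_lt q.continuous.norm continuous_const).inter hu.isOpen_compl
    have hBe : B = ∅ := by
      rcases isClopen_iff.1 ⟨hBcl, hBop⟩ with h | h
      · exact h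
      · exfalso
        have : IsCompact (univ : Set ℂ) := by
          rw [← h]
          exact hNcpt.inter_right hv
        exact noncompact_univ ℂ this
    intro c hc
    refine (huv hc).resolve_right fun hcv => ?_
    have : c ∈ B := ⟨hc, hcv⟩
    rw [hBe] at this
    exact this
  intro u v hu hv huv hd'
  have hLN : {c : ℂ | ‖q.eval c‖ = t} ⊆ {c : ℂ | ‖q.eval c‖ ≤ t} := fun c hc => le_of_eq hc
  rcases isPreconnected_iff_subset_of_disjoint_closed.1 hL u v hu hv (hLN.trans huv)
    (by rw [hd'.inter_eq, inter_empty]) with h | h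
  · exact Or.inl (key u v hu hv huv hd' h)
  · exact Or.inr (key v u hv hu (by rwa [union_comm]) hd'.symm h)

/-! ### The family of inverse Böttcher coordinates -/

open scoped unitInterval in
lemma sqrt_lift {A : Type*} [TopologicalSpace A] (H : I × A → ℂ) (hH : Continuous H)
    (hne : ∀ p, H p ≠ 0) (h0 : ∀ a, H (0, a) = 1) :
    ∃ s : A → ℂ, Continuous s ∧ (∀ a, s a ^ 2 = H (1, a)) ∧
      ∀ a, (∀ t, H (t, a) = 1) → s a = 1 := by
  have cov := isCoveringMap_npow (𝕜 := ℂ) 2 (by norm_num)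
  let H' : C(I × A, {x : ℂ // x ≠ 0}) := ⟨fun p => ⟨H p, hne p⟩, by fun_prop⟩
  let f : C(A, {x : ℂ // x ≠ 0}) := ⟨fun _ => ⟨1, one_ne_zero⟩, continuous_const⟩
  have H0 : ∀ a, H' (0, a) = (fun x : {x : ℂ // x ≠ 0} ↦
      (⟨x ^ 2, pow_ne_zero 2 x.2⟩ : {x : ℂ // x ≠ 0})) (f a) := by
    intro a
    apply Subtype.ext
    simp [H', f, h0]
  refine ⟨fun a => (cov.liftHomotopy H' f H0 (1, a)).1, by fun_prop, fun a => ?_, fun a ha => ?_⟩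
  · have := congr_fun (cov.liftHomotopy_lifts H' f H0) (1, a)
    exact congr_arg Subtype.val this
  · have h1 : (ContinuousMap.const I (⟨1, one_ne_zero⟩ : {x : ℂ // x ≠ 0})) =
        cov.liftPath (H'.comp <| (ContinuousMap.id I).prodMk <| .const I a) (f a) (H0 a) := by
      refine (cov.eq_liftPath_iff' _).2 ⟨?_, rfl⟩
      funext t
      apply Subtype.ext
      simp [H', ha]
    exact congr_arg (fun γ : C(I, {x : ℂ // x ≠ 0}) => (γ 1).1) h1.symm

/-- Domain of the inverse Böttcher coordinate. -/
def D (n j : ℕ) : Set (ℂ × ℂ) := {p | 3 < ‖Q n p.1‖ ∧ ‖p.2‖ ^ (2 ^ j) * ‖Q n p.1‖ < 1}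

lemma D_sq {n j : ℕ} {c u : ℂ} : (c, u ^ 2) ∈ D n j ↔ (c, u) ∈ D n (j + 1) := by
  have : ‖u ^ 2‖ ^ (2 ^ j) = ‖u‖ ^ (2 ^ (j + 1)) := by
    rw [norm_pow, ← pow_mul, pow_succ' 2 j]
  simp only [D, mem_ofPred_eq]
  rw [this]

lemma D_norm {n j : ℕ} {c u : ℂ} (h : (c, u) ∈ D n j) (hu : u ≠ 0) :
    ‖Q n c‖ < ‖(1 / u) ^ (2 ^ j)‖ := by
  have h2 : ‖u‖ ^ (2 ^ j) * ‖Q n c‖ < 1 := h.2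
  have : 0 < ‖u‖ ^ (2 ^ j) := pow_pos (norm_pos_iff.2 hu) _
  rw [norm_pow, norm_div, norm_one, div_pow, one_pow, lt_div_iff₀ this]
  linarith

open scoped unitInterval in
lemma family (n j : ℕ) (hj : j ≤ n) : ∃ k : ℂ × ℂ → ℂ, ContinuousOn k (D n j) ∧
    (∀ c, 3 < ‖Q n c‖ → k (c, 0) = 1) ∧
    (∀ c u, (c, u) ∈ D n j → u ≠ 0 → it j c (k (c, u) / u) = (1 / u) ^ (2 ^ j)) ∧
    (∀ c u u', (c, u) ∈ D n j → (c, u') ∈ D n j → u ≠ 0 → u' ≠ 0 →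
      k (c, u) / u = k (c, u') / u' → u = u') ∧
    (∀ c z, 3 < ‖Q n c‖ → ‖Q n c‖ < ‖it j c z‖ →
      ∃ u, u ≠ 0 ∧ (c, u) ∈ D n j ∧ k (c, u) / u = z) := by
  induction j with
  | zero =>
    refine ⟨fun _ => 1, continuousOn_const, fun _ _ => rfl, fun c u _ _ => by simp, ?_, ?_⟩
    · intro c u u' _ _ hu hu' h
      field_simp at h
      exact h.symm
    · intro c z h3 hz
      simp only [it_zero] at hz
      have hz0 : z ≠ 0 := by
        rw [← norm_pos_iff]
        linarith
      refine ⟨1 / z, by simpa using hz0, ⟨h3, ?_⟩, by simp⟩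
      simp only [pow_zero, pow_one, norm_div, norm_one]
      rw [one_div, ← div_eq_inv_mul, div_lt_one (by linarith)]
      exact hz
  | succ j ih =>
    obtain ⟨k, hk, hk0, hkit, hkinj, hksurj⟩ := ih (by omega)
    have hne : ∀ p ∈ D n j, k p - p.1 * p.2 ≠ 0 := by
      rintro ⟨c, v⟩ hp h
      simp only at h
      by_cases hv : v = 0
      · subst hv
        rw [hk0 c hp.1] at h
        simp at h
      · have h1 : k (c, v) / v = c := by
          rw [div_eq_iff hv]
          linear_combination h
        have h2 := hkit c v hp hv
        rw [h1, ← Q_succ'] at h2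
        have h3 := D_norm hp hv
        rw [← h2] at h3
        exact absurd (Q_le_of_le hj hp.1) (not_le.2 h3)
    have hstar : ∀ (t : I) (p : ℂ × ℂ), p ∈ D n j → (p.1, (t : ℂ) * p.2) ∈ D n j := by
      rintro t ⟨c, v⟩ ⟨h1, h2⟩
      refine ⟨h1, lt_of_le_of_lt ?_ h2⟩
      simp only
      gcongr
      rw [norm_mul, Complex.norm_real, Real.norm_eq_abs, abs_of_nonneg t.2.1]
      exact mul_le_of_le_one_left (norm_nonneg _) t.2.2
    let g : I × D n j → ℂ × ℂ := fun q => (q.2.1.1, ((q.1 : ℝ) : ℂ) * q.2.1.2)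
    have hg : Continuous g := by fun_prop
    have hgD : ∀ q, g q ∈ D n j := fun q => hstar q.1 q.2.1 q.2.2
    obtain ⟨s, hs, hs2, hs1⟩ := sqrt_lift (A := D n j) (fun q => k (g q) - (g q).1 * (g q).2)
      ((hk.comp_continuous hg hgD).sub (by fun_prop)) (fun q => hne _ (hgD q))
      (fun a => by simp [g, hk0 a.1.1 a.2.1])
    classical
    let S : ℂ × ℂ → ℂ := fun p => if h : p ∈ D n j then s ⟨p, h⟩ else 0
    have hSs : ∀ p : D n j, S p.1 = s p := fun p => by simp only [S]; rw [dif_pos p.2]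
    have hSc : ContinuousOn S (D n j) := by
      rw [continuousOn_iff_continuous_domRestrict]
      refine hs.congr fun p => ?_
      rw [domRestrict_apply, hSs]
    have hS2 : ∀ c v, (c, v) ∈ D n j → S (c, v) ^ 2 = k (c, v) - c * v := by
      intro c v h
      rw [hSs ⟨(c, v), h⟩, hs2]
      simp [g]
    -- the new function
    have hrec : ∀ c u, (c, u) ∈ D n (j + 1) → u ≠ 0 →
        (S (c, u ^ 2) / u) ^ 2 + c = k (c, u ^ 2) / u ^ 2 := by
      intro c u h hu
      rw [div_pow, hS2 c _ (D_sq.2 h)]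
      field_simp
      ring
    have hSne : ∀ c v, (c, v) ∈ D n j → S (c, v) ≠ 0 := by
      intro c v h h0
      have := hS2 c v h
      rw [h0] at this
      exact hne _ h (by rw [← this]; simp)
    refine ⟨fun p => S (p.1, p.2 ^ 2), ?_, ?_, ?_, ?_, ?_⟩
    · exact hSc.comp (by fun_prop : Continuous fun p : ℂ × ℂ => (p.1, p.2 ^ 2)).continuousOn
        fun p hp => D_sq.2 hp
    · intro c hc
      have hD : (c, (0 : ℂ)) ∈ D n j := ⟨hc, by simp⟩
      simp only [ne_eq, OfNat.ofNat_ne_zero, not_false_eq_true, zero_pow]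
      rw [hSs ⟨_, hD⟩]
      exact hs1 _ fun t => by simp [g, hk0 c hc]
    · intro c u h hu
      rw [it_succ', hrec c u h hu, hkit c _ (D_sq.2 h) (pow_ne_zero _ hu)]
      rw [pow_succ' 2 j, pow_mul (1 / u)]
      congr 1
      rw [div_pow, one_pow]
    · intro c u u' h h' hu hu' he
      have e1 := hrec c u h hu
      have e2 := hrec c u' h' hu'
      simp only at he
      have e3 : u ^ 2 = u' ^ 2 := hkinj c _ _ (D_sq.2 h) (D_sq.2 h') (pow_ne_zero _ hu)
        (pow_ne_zero _ hu') (by rw [← e1, ← e2, he])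
      rcases sq_eq_sq_iff_eq_or_eq_neg.1 e3 with e4 | e4
      · exact e4
      · exfalso
        rw [e3, e4] at he
        have h5 := hSne c _ (D_sq.2 h')
        field_simp at he
        norm_num at he
    · intro c z hc hz
      rw [it_succ'] at hz
      obtain ⟨v, hv, hvD, hvz⟩ := hksurj c _ hc hz
      obtain ⟨u, hu⟩ := IsAlgClosed.exists_pow_nat_eq v (n := 2) (by norm_num)
      subst hu
      have hu0 : u ≠ 0 := by
        rintro rfl
        simp at hv
      have hD := D_sq.1 hvD
      have e1 := hrec c u hD hu0
      rw [hvz] at e1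
      have e2 : (S (c, u ^ 2) / u) ^ 2 = z ^ 2 := by linear_combination e1
      rcases sq_eq_sq_iff_eq_or_eq_neg.1 e2 with e3 | e3
      · exact ⟨u, hu0, hD, e3⟩
      · refine ⟨-u, neg_ne_zero.2 hu0, ?_, ?_⟩
        · rw [← D_sq, neg_sq]
          exact hvD
        · simp only [neg_sq]
          rw [div_neg, e3, neg_neg]

lemma exists_root (n : ℕ) : ∃ Φ : {c : ℂ // 3 < ‖Q n c‖} → ℂ, Continuous Φ ∧
    ∀ c, Φ c ^ (2 ^ n) = Q (n + 1) c.1 := by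
  obtain ⟨k, hk, hk0, hkit, hkinj, hksurj⟩ := family n n le_rfl
  have hex : ∀ c : {c : ℂ // 3 < ‖Q n c‖}, ∃ u, u ≠ 0 ∧ (c.1, u) ∈ D n n ∧
      k (c.1, u) / u = c.1 := fun c =>
    hksurj c.1 c.1 c.2 (by rw [← Q_succ']; exact Q_lt_succ c.2)
  choose μ hμ0 hμD hμ using hex
  have hμQ : ∀ c, (1 / μ c) ^ (2 ^ n) = Q (n + 1) c.1 := fun c => by
    rw [Q_succ', ← hkit _ _ (hμD c) (hμ0 c), hμ]
  have hd : (2 ^ n : ℕ) ≠ 0 := by positivity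
  have hμQ' : ∀ c, μ c ^ (2 ^ n) * Q (n + 1) c.1 = 1 := fun c => by
    rw [← hμQ, ← mul_pow, mul_one_div_cancel (hμ0 c), one_pow]
  have hopen : IsOpen (D n n) := by
    refine (isOpen_lt continuous_const ((Q_continuous n).comp continuous_fst).norm).inter
      (isOpen_lt (((continuous_snd.norm).pow _).mul
        ((Q_continuous n).comp continuous_fst).norm) continuous_const)
  have hcont : Continuous μ := by
    rw [continuous_iff_continuousAt]
    intro c₀
    refine (isCompact_closedBall (0 : ℂ) 1).tendsto_nhds_of_unique_mapClusterPt
      (Eventually.of_forall fun c => ?_) fun u _ hu => ?_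
    · rw [mem_closedBall_zero_iff]
      by_contra hlt
      push Not at hlt
      have h1 := (hμD c).2
      simp only at h1
      have h2 : 1 < ‖μ c‖ ^ (2 ^ n) := one_lt_pow₀ hlt hd
      have h3 := c.2
      nlinarith
    · rw [mapClusterPt_iff_ultrafilter] at hu
      obtain ⟨U, hU, hUu⟩ := hu
      have hUc : Tendsto (fun c : {c : ℂ // 3 < ‖Q n c‖} => c.1) U (𝓝 c₀.1) :=
        (continuous_subtype_val.tendsto c₀).mono_left hU
      have h1 : u ^ (2 ^ n) * Q (n + 1) c₀.1 = 1 := by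
        refine tendsto_nhds_unique ((hUu.pow _).mul
          (((Q_continuous (n + 1)).tendsto _).comp hUc)) ?_
        refine tendsto_const_nhds.congr fun c => ?_
        exact (hμQ' c).symm
      have hu0 : u ≠ 0 := by
        rintro rfl
        rw [zero_pow hd] at h1
        simp at h1
      have huD : (c₀.1, u) ∈ D n n := by
        refine ⟨c₀.2, ?_⟩
        have h2 := congr_arg norm h1
        rw [norm_mul, norm_pow, norm_one] at h2
        rw [← h2]
        exact mul_lt_mul_of_pos_left (Q_lt_succ c₀.2) (pow_pos (norm_pos_iff.2 hu0) _)
      have hkc : ContinuousAt k (c₀.1, u) := hk.continuousAt (hopen.mem_nhds huD)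
      have h3 : k (c₀.1, u) = c₀.1 * u := by
        refine tendsto_nhds_unique (hkc.tendsto.comp (hUc.prodMk_nhds hUu)) ?_
        refine (hUc.mul hUu).congr fun c => ?_
        have := hμ c
        rw [div_eq_iff (hμ0 c)] at this
        exact this.symm
      refine hkinj _ _ _ huD (hμD c₀) hu0 (hμ0 c₀) ?_
      rw [hμ, h3, mul_div_cancel_right₀ _ hu0]
  exact ⟨fun c => 1 / μ c, continuous_const.div hcont hμ0, hμQ⟩

/-! ### The polynomial and conclusion -/

/-- The polynomial of the critical orbit. -/
noncomputable def qp : ℕ → Polynomial ℂ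
  | 0 => Polynomial.X
  | n + 1 => qp n ^ 2 + Polynomial.X

lemma qp_eval (n : ℕ) (c : ℂ) : (qp n).eval c = Q (n + 1) c := by
  induction n with
  | zero => simp [qp, Q, it_succ]
  | succ n ih => rw [Q_succ, ← ih]; simp [qp]

lemma qp_natDegree (n : ℕ) : (qp n).natDegree = 2 ^ n := by
  induction n with
  | zero => simp [qp]
  | succ n ih =>
    have h1 : (qp n ^ 2).natDegree = 2 ^ (n + 1) := by
      rw [Polynomial.natDegree_pow, ih, pow_succ']
    rw [qp, Polynomial.natDegree_add_eq_left_of_natDegree_lt, h1]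
    rw [h1, Polynomial.natDegree_X]
    exact Nat.one_lt_two_pow (by omega)

lemma level_preconnected (n : ℕ) : IsPreconnected {c : ℂ | ‖Q (n + 1) c‖ ≤ 13} := by
  rcases Nat.eq_zero_or_pos n with rfl | hn
  · have : {c : ℂ | ‖Q (0 + 1) c‖ ≤ 13} = Metric.closedBall 0 13 := by
      ext c
      simp [Q, it_succ]
    rw [this]
    exact Metric.isPreconnected_closedBall
  obtain ⟨Φ, hΦ, hΦd⟩ := exists_root n
  have hsub : ∀ c : ℂ, 12 < ‖(qp n).eval c‖ → 3 < ‖Q n c‖ := by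
    intro c hc
    rw [qp_eval] at hc
    by_contra hlt
    push Not at hlt
    have hcn : ‖c‖ ≤ 3 := by
      obtain ⟨m, rfl⟩ : ∃ m, n = m + 1 := ⟨n - 1, by omega⟩
      exact norm_c_le le_rfl hlt
    have := norm_add_le (Q n c ^ 2) c
    rw [← Q_succ, norm_pow] at this
    nlinarith [norm_nonneg (Q n c)]
  have := sublevel_preconnected (qp n) (d := 2 ^ n) (by positivity) (qp_natDegree n)
    (r := 12) (t := 13) (by norm_num) (by norm_num) (fun c => Φ ⟨c.1, hsub c.1 c.2⟩)
    (by fun_prop) (fun c => by rw [hΦd, qp_eval])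
  simpa only [qp_eval] using this

end MandelAux

/-- The Mandelbrot set is compact and connected (Douady–Hubbard). -/
theorem mandelbrot_compact_connected :
    IsCompact mandelbrot ∧ IsConnected mandelbrot := by
  have hanti : Antitone fun n => {c : ℂ | ‖MandelAux.Q (n + 1) c‖ ≤ 13} := by
    refine antitone_nat_of_succ_le fun n c hc => ?_
    by_contra hlt
    have hlt : 13 < ‖MandelAux.Q (n + 1) c‖ := not_le.1 hlt
    have hc : ‖MandelAux.Q (n + 1 + 1) c‖ ≤ 13 := hc
    have := MandelAux.Q_lt_succ (c := c) (n := n + 1) (by linarith)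
    linarith
  have hcpt : ∀ n, IsCompact {c : ℂ | ‖MandelAux.Q (n + 1) c‖ ≤ 13} := by
    intro n
    refine (isCompact_closedBall (0 : ℂ) 13).of_isClosed_subset
      (isClosed_le (MandelAux.Q_continuous _).norm continuous_const) fun c hc => ?_
    rw [mem_closedBall_zero_iff]
    exact MandelAux.norm_c_le (by norm_num) hc
  rw [MandelAux.mandelbrot_eq_iInter]
  refine ⟨(hcpt 0).of_isClosed_subset (isClosed_iInter fun n => (hcpt n).isClosed)
    (Set.iInter_subset _ 0), ⟨0, ?_⟩,
    MandelAux.isPreconnected_iInter hanti hcpt MandelAux.level_preconnected⟩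
  refine Set.mem_iInter.2 fun n => ?_
  have : ∀ n, MandelAux.Q n 0 = 0 := by
    intro n
    induction n with
    | zero => rfl
    | succ n ih => rw [MandelAux.Q_succ, ih]; simp
  change ‖MandelAux.Q (n + 1) 0‖ ≤ 13
  rw [this]
  simp
end
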